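/- Suppose m > 1 and B ⊊ DK(A). Then there exists l ∈ {1,…,m} such that for the integral domain A_l := k(X_l)[X_1,…,X_{l−1},X_{l+1},…,X_m,Y,Z,T]/(X_1^{r_1}⋯X_m^{r_m}Y − f(Z,T)), an affine domain over the rational function field k(X_l), the image y′ of Y in A_l lies in DK(A_l) (Derksen invariant taken with respect to exponential maps of k(X_l)-algebras); in particular DK(A_l) = A_l. -/

import Mathlib

/-!
Common definitions: exponential maps, the Derksen and Makar-Limanov invariants,
𝔸ⁿ-fibrations, and the ring
`A = k[X_1,…,X_m,Y,Z,T]/(X_1^{r_1}⋯X_m^{r_m}·Y − F(X_1,…,X_m,Z,T))`.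
-/

noncomputable section
open MvPolynomial

/-- An exponential map on a `k`-algebra `D`: a `k`-algebra homomorphism `φ : D → D[U]`
such that evaluating `U` at `0` gives the identity of `D`, and such that
`φ_V ∘ φ_U = φ_{U+V}` in `D[U,V]` (where `φ_V : D[U] → D[U,V]` extends `φ` with
`φ_V(U) = U`).  Here `D[U,V]` is modelled as `Polynomial (Polynomial D)`, with inner
variable `U` and outer variable `V`. -/
structure ExpMap (k D : Type) [CommRing k] [CommRing D] [Algebra k D] where
  toAlgHom : D →ₐ[k] Polynomial D
  eval_zero : ∀ d, Polynomial.eval 0 (toAlgHom d) = d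
  comp_add : ∀ d,
    Polynomial.eval₂ ((Polynomial.mapRingHom (Polynomial.C (R := D))).comp toAlgHom.toRingHom)
      (Polynomial.C Polynomial.X) (toAlgHom d)
    = Polynomial.eval₂ ((Polynomial.C (R := Polynomial D)).comp (Polynomial.C (R := D)))
      (Polynomial.C Polynomial.X + Polynomial.X) (toAlgHom d)

namespace ExpMap
variable {k D : Type} [CommRing k] [CommRing D] [Algebra k D]

/-- The ring of invariants `D^φ = {d ∈ D | φ(d) = d}` of an exponential map. -/
def invariants (φ : ExpMap k D) : Subalgebra k D where
  carrier := {d | φ.toAlgHom d = Polynomial.C d}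
  mul_mem' := fun ha hb => by
    simp only [Set.mem_setOf_eq] at *
    rw [map_mul, ha, hb, ← map_mul]
  add_mem' := fun ha hb => by
    simp only [Set.mem_setOf_eq] at *
    rw [map_add, ha, hb, ← map_add]
  algebraMap_mem' := fun c => by
    simp only [Set.mem_setOf_eq, AlgHom.commutes, Polynomial.algebraMap_apply]

end ExpMap

/-- The Derksen invariant `DK(D)`: the `k`-subalgebra of `D` generated by the rings of
invariants of all non-trivial exponential maps on `D`. -/
def Derksen (k D : Type) [CommRing k] [CommRing D] [Algebra k D] : Subalgebra k D :=
  Algebra.adjoin k (⋃ φ ∈ {ψ : ExpMap k D | ψ.invariants ≠ ⊤}, (φ.invariants : Set D))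

/-- The Makar-Limanov invariant `ML(D)`: the intersection of the rings of invariants of
all exponential maps on `D`. -/
def MakarLimanov (k D : Type) [CommRing k] [CommRing D] [Algebra k D] : Subalgebra k D :=
  ⨅ φ : ExpMap k D, φ.invariants

/-- `D` is an `𝔸ⁿ`-fibration over `R`: a finitely generated flat `R`-algebra all of whose
fibres `D ⊗_R κ(p)` over primes `p` of `R` are polynomial rings `κ(p)^{[n]}`. -/
def IsAnFibration (R D : Type) [CommRing R] [CommRing D] [Algebra R D] (n : ℕ) : Prop :=
  Algebra.FiniteType R D ∧ Module.Flat R D ∧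
  ∀ p : PrimeSpectrum R,
    Nonempty ((TensorProduct R (IsLocalRing.ResidueField (Localization.AtPrime p.asIdeal)) D)
      ≃ₐ[IsLocalRing.ResidueField (Localization.AtPrime p.asIdeal)]
      MvPolynomial (Fin n) (IsLocalRing.ResidueField (Localization.AtPrime p.asIdeal)))

/-- The polynomial ring `k[X_1,…,X_m,Y,Z,T]`:
variables `Sum.inl i` are the `X i`; `Sum.inr 0 = Y`, `Sum.inr 1 = Z`, `Sum.inr 2 = T`. -/
abbrev BigP (k : Type) [CommRing k] (m : ℕ) := MvPolynomial (Fin m ⊕ Fin 3) k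

/-- The inclusion `k[X_1,…,X_m,Z,T] → k[X_1,…,X_m,Y,Z,T]` (in the source,
`Sum.inr 0 = Z` and `Sum.inr 1 = T`). -/
def incl (k : Type) [CommRing k] (m : ℕ) : MvPolynomial (Fin m ⊕ Fin 2) k →ₐ[k] BigP k m :=
  rename (Sum.map id Fin.succ)

/-- The polynomial `G = X_1^{r_1}⋯X_m^{r_m}·Y − F(X_1,…,X_m,Z,T)`. -/
def relG (k : Type) [CommRing k] (m : ℕ) (r : Fin m → ℕ) (F : MvPolynomial (Fin m ⊕ Fin 2) k) :
    BigP k m :=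
  (∏ i, X (Sum.inl i) ^ r i) * X (Sum.inr 0) - incl k m F

/-- The ring `A = k[X_1,…,X_m,Y,Z,T]/(X_1^{r_1}⋯X_m^{r_m}·Y − F(X_1,…,X_m,Z,T))`. -/
abbrev RingA (k : Type) [CommRing k] (m : ℕ) (r : Fin m → ℕ)
    (F : MvPolynomial (Fin m ⊕ Fin 2) k) :=
  BigP k m ⧸ Ideal.span {relG k m r F}

variable (k : Type) [CommRing k] (m : ℕ) (r : Fin m → ℕ) (F : MvPolynomial (Fin m ⊕ Fin 2) k)

/-- `x i`, the image of `X i` in `A`. -/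
def xA (i : Fin m) : RingA k m r F := Ideal.Quotient.mk _ (X (Sum.inl i))
/-- `y`, the image of `Y` in `A`. -/
def yA : RingA k m r F := Ideal.Quotient.mk _ (X (Sum.inr 0))
/-- `z`, the image of `Z` in `A`. -/
def zA : RingA k m r F := Ideal.Quotient.mk _ (X (Sum.inr 1))
/-- `t`, the image of `T` in `A`. -/
def tA : RingA k m r F := Ideal.Quotient.mk _ (X (Sum.inr 2))

/-- `f(Z,T) := F(0,…,0,Z,T) ∈ k[Z,T]`. -/
def fOf : MvPolynomial (Fin 2) k :=
  aeval (Sum.elim (fun _ => (0 : MvPolynomial (Fin 2) k)) X) F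

/-- The subalgebra `E = k[x_1,…,x_m]` of `A`. -/
def EA : Subalgebra k (RingA k m r F) := Algebra.adjoin k (Set.range (xA k m r F))

/-- The subalgebra `B = k[x_1,…,x_m,z,t]` of `A`. -/
def BA : Subalgebra k (RingA k m r F) :=
  Algebra.adjoin k (Set.range (xA k m r F) ∪ {zA k m r F, tA k m r F})

/-!
STATEMENT 11 (Lemma `fdk2`).  Suppose `m > 1` and `B ⊊ DK(A)`.  Then there exists
`l ∈ {1,…,m}` such that, for the affine domain
`A_l = k(X_l)[X_1,…,X_{l−1},X_{l+1},…,X_m,Y,Z,T]/(X_1^{r_1}⋯X_m^{r_m}Y − f(Z,T))` over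
the rational function field `k(X_l)`, the image `y′` of `Y` in `A_l` lies in `DK(A_l)`;
in particular `DK(A_l) = A_l`.
-/

/-- The variables of `A_l`: the `X_i` for `i ≠ l`, together with `Y, Z, T`. -/
abbrev VarL (l : Fin m) := {i : Fin m // i ≠ l} ⊕ Fin 3

/-- The relation `X_1^{r_1}⋯X_m^{r_m}·Y − f(Z,T)` in
`k(X_l)[X_i (i ≠ l), Y, Z, T]`, where `X_l` is the generator of `k(X_l)`. -/
def relL (k : Type) [Field k] (m : ℕ) (r : Fin m → ℕ) (F : MvPolynomial (Fin m ⊕ Fin 2) k)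
    (l : Fin m) : MvPolynomial (VarL m l) (RatFunc k) :=
  C RatFunc.X ^ r l * (∏ i : {i : Fin m // i ≠ l}, X (Sum.inl i) ^ r i.1) * X (Sum.inr 0)
    - aeval (R := k) (fun j : Fin 2 => X (Sum.inr j.succ)) (fOf k m F)

/-- The ring `A_l`, an affine domain over `k(X_l)`. -/
abbrev RingAL (k : Type) [Field k] (m : ℕ) (r : Fin m → ℕ)
    (F : MvPolynomial (Fin m ⊕ Fin 2) k) (l : Fin m) :=
  MvPolynomial (VarL m l) (RatFunc k) ⧸ Ideal.span {relL k m r F l}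

/-- `y′`, the image of `Y` in `A_l`. -/
def yL (k : Type) [Field k] (m : ℕ) (r : Fin m → ℕ) (F : MvPolynomial (Fin m ⊕ Fin 2) k)
    (l : Fin m) : RingAL k m r F l :=
  Ideal.Quotient.mk _ (X (Sum.inr 0))

/-! ### Exponential maps -/

namespace ExpMap

section General
variable {k D : Type} [CommRing k] [CommRing D] [Algebra k D]

theorem mem_invariants {φ : ExpMap k D} {d : D} :
    d ∈ φ.invariants ↔ φ.toAlgHom d = Polynomial.C d := Iff.rfl

/-- The homomorphism `φ_V ∘ φ_U` attached to `φ : D → D[U]`. -/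
def iterHom (φ : D →ₐ[k] Polynomial D) : D →+* Polynomial (Polynomial D) :=
  (Polynomial.eval₂RingHom
    ((Polynomial.mapRingHom (Polynomial.C (R := D))).comp φ.toRingHom)
      (Polynomial.C Polynomial.X)).comp φ.toRingHom

/-- The homomorphism `φ_{U+V}` attached to `φ : D → D[U]`. -/
def shiftHom (φ : D →ₐ[k] Polynomial D) : D →+* Polynomial (Polynomial D) :=
  (Polynomial.eval₂RingHom
    ((Polynomial.C (R := Polynomial D)).comp (Polynomial.C (R := D)))
      (Polynomial.C Polynomial.X + Polynomial.X)).comp φ.toRingHom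

theorem coeff_coeff_iterHom (φ : D →ₐ[k] Polynomial D) (d : D) (i n : ℕ) :
    ((iterHom φ d).coeff i).coeff n = (φ ((φ d).coeff n)).coeff i := by
  have h : iterHom φ d = ∑ j ∈ (φ d).support,
      (φ ((φ d).coeff j)).map Polynomial.C * Polynomial.C (Polynomial.X ^ j) := by
    simp [iterHom, Polynomial.eval₂_def, Polynomial.sum_def]
  rw [h]
  simp only [Polynomial.finsetSum_coeff, Polynomial.coeff_mul_C, Polynomial.coeff_map,
    Polynomial.coeff_C_mul, Polynomial.coeff_X_pow]
  rw [Finset.sum_eq_single n]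
  · simp
  · intro b _ hb
    simp [hb.symm]
  · intro hn
    simp [Polynomial.notMem_support_iff.mp hn]

theorem coeff_coeff_shiftHom (φ : D →ₐ[k] Polynomial D) (d : D) (i n : ℕ) :
    ((shiftHom φ d).coeff i).coeff n = (φ d).coeff (n + i) * ((n + i).choose i : D) := by
  have h : shiftHom φ d = ∑ j ∈ (φ d).support,
      Polynomial.C (Polynomial.C ((φ d).coeff j)) *
        (Polynomial.X + Polynomial.C Polynomial.X) ^ j := by
    simp [shiftHom, Polynomial.eval₂_def, Polynomial.sum_def, add_comm]
  rw [h]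
  simp only [Polynomial.finsetSum_coeff, Polynomial.coeff_C_mul,
    Polynomial.coeff_X_add_C_pow, Polynomial.coeff_mul_natCast, Polynomial.coeff_X_pow]
  rw [Finset.sum_eq_single (n + i)]
  · simp
  · intro b _ hb
    by_cases hbi : i ≤ b
    · have : n ≠ b - i := by omega
      simp [this]
    · simp [Nat.choose_eq_zero_of_lt (not_le.mp hbi)]
  · intro hn
    simp [Polynomial.notMem_support_iff.mp hn]

/-- The iteration identity `φ_V ∘ φ_U = φ_{U+V}` at a single element. -/
def IterAt (φ : D →ₐ[k] Polynomial D) (d : D) : Prop :=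
  ∀ i n, (φ ((φ d).coeff n)).coeff i = (φ d).coeff (n + i) * ((n + i).choose i : D)

theorem iterAt_iff (φ : D →ₐ[k] Polynomial D) (d : D) :
    IterAt φ d ↔ iterHom φ d = shiftHom φ d := by
  constructor
  · intro h
    ext i n
    rw [coeff_coeff_iterHom, coeff_coeff_shiftHom, h]
  · intro h i n
    rw [← coeff_coeff_iterHom, ← coeff_coeff_shiftHom, h]

theorem iterAt (φ : ExpMap k D) (d : D) : IterAt φ.toAlgHom d :=
  (iterAt_iff _ _).2 (φ.comp_add d)

theorem iterAt_algebraMap (φ : D →ₐ[k] Polynomial D) (c : k) : IterAt φ (algebraMap k D c) := by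
  rw [iterAt_iff]
  simp [iterHom, shiftHom, Polynomial.algebraMap_apply]

theorem iterAt_of_mem_adjoin (φ : D →ₐ[k] Polynomial D) {s : Set D} (hs : ∀ d ∈ s, IterAt φ d)
    {d : D} (hd : d ∈ Algebra.adjoin k s) : IterAt φ d := by
  induction hd using Algebra.adjoin_induction with
  | mem x hx => exact hs x hx
  | algebraMap c => exact iterAt_algebraMap φ c
  | add x y _ _ hx hy => rw [iterAt_iff] at *; rw [map_add, map_add, hx, hy]
  | mul x y _ _ hx hy => rw [iterAt_iff] at *; rw [map_mul, map_mul, hx, hy]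

/-- An exponential map from an algebra homomorphism satisfying the axioms on generators. -/
def ofGenerators (φ : D →ₐ[k] Polynomial D) (s : Set D) (hs : Algebra.adjoin k s = ⊤)
    (h0 : ∀ d ∈ s, (φ d).coeff 0 = d) (h1 : ∀ d ∈ s, IterAt φ d) : ExpMap k D where
  toAlgHom := φ
  eval_zero d := by
    have hd : d ∈ Algebra.adjoin k s := hs ▸ Algebra.mem_top
    rw [← Polynomial.coeff_zero_eq_eval_zero]
    induction hd using Algebra.adjoin_induction with
    | mem x hx => exact h0 x hx
    | algebraMap c => simp [Polynomial.algebraMap_apply]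
    | add x y _ _ hx hy => rw [map_add, Polynomial.coeff_add, hx, hy]
    | mul x y _ _ hx hy => rw [map_mul, Polynomial.mul_coeff_zero, hx, hy]
  comp_add d := (iterAt_iff φ d).1 (iterAt_of_mem_adjoin φ h1 (hs ▸ Algebra.mem_top))

theorem coeff_zero (φ : ExpMap k D) (d : D) : (φ.toAlgHom d).coeff 0 = d := by
  rw [Polynomial.coeff_zero_eq_eval_zero, φ.eval_zero]

theorem injective (φ : ExpMap k D) : Function.Injective φ.toAlgHom := by
  intro a b h
  rw [← φ.coeff_zero a, h, φ.coeff_zero]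

theorem mem_invariants_iff_coeff {φ : ExpMap k D} {d : D} :
    d ∈ φ.invariants ↔ ∀ n, (φ.toAlgHom d).coeff (n + 1) = 0 := by
  rw [mem_invariants]
  constructor
  · intro h n
    rw [h, Polynomial.coeff_C_succ]
  · intro h
    ext n
    cases n with
    | zero => rw [φ.coeff_zero, Polynomial.coeff_C_zero]
    | succ n => rw [h, Polynomial.coeff_C_succ]

theorem mem_invariants_iff_natDegree {φ : ExpMap k D} {d : D} :
    d ∈ φ.invariants ↔ (φ.toAlgHom d).natDegree = 0 := by
  rw [mem_invariants_iff_coeff]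
  constructor
  · intro h
    rw [Polynomial.natDegree_eq_zero_iff_degree_le_zero, Polynomial.degree_le_zero_iff]
    ext n
    cases n with
    | zero => simp
    | succ n => rw [h, Polynomial.coeff_C_succ]
  · intro h n
    exact Polynomial.coeff_eq_zero_of_natDegree_lt (by omega)

/-- Rings of invariants are factorially closed. -/
theorem mem_invariants_of_mul [IsDomain D] {φ : ExpMap k D} {a b : D}
    (hab : a * b ∈ φ.invariants) (h : a * b ≠ 0) : a ∈ φ.invariants := by
  rw [mem_invariants_iff_natDegree] at hab ⊢
  rw [map_mul, Polynomial.natDegree_mul] at hab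
  · omega
  · intro ha
    exact h (by rw [φ.injective (ha.trans (map_zero _).symm), zero_mul])
  · intro hb
    exact h (by rw [φ.injective (hb.trans (map_zero _).symm), mul_zero])

theorem mem_invariants_of_dvd [IsDomain D] {φ : ExpMap k D} {a b : D}
    (hb : b ∈ φ.invariants) (h : b ≠ 0) (hab : a ∣ b) : a ∈ φ.invariants := by
  obtain ⟨c, rfl⟩ := hab
  exact mem_invariants_of_mul hb h

theorem coeff_mem_invariants {φ : ExpMap k D} {d : D} {n : ℕ}
    (h : (φ.toAlgHom d).degree < (n + 1 : ℕ)) : (φ.toAlgHom d).coeff n ∈ φ.invariants := by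
  rw [mem_invariants_iff_coeff]
  intro i
  rw [φ.iterAt d, Polynomial.coeff_eq_zero_of_degree_lt, zero_mul]
  refine h.trans_le ?_
  exact_mod_cast (by omega : n + 1 ≤ n + (i + 1))

/-- More than `M` elements of `U`-degree less than `M` are dependent over the invariants. -/
theorem exists_dependence [IsDomain D] (φ : ExpMap k D) {ι : Type} [DecidableEq ι] (M : ℕ) :
    ∀ (s : Finset ι) (v : ι → D), M < s.card → (∀ i ∈ s, (φ.toAlgHom (v i)).degree < M) →
      ∃ c : ι → D, (∀ i, c i ∈ φ.invariants) ∧ (∃ i ∈ s, c i ≠ 0) ∧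
        ∑ i ∈ s, c i * v i = 0 := by
  induction M with
  | zero =>
    intro s v hs hv
    obtain ⟨i, hi⟩ := Finset.card_pos.mp hs
    refine ⟨fun _ => 1, fun _ => one_mem _, ⟨i, hi, one_ne_zero⟩, ?_⟩
    refine Finset.sum_eq_zero fun j hj => ?_
    have h := hv j hj
    rw [Nat.cast_zero, Nat.WithBot.lt_zero_iff, Polynomial.degree_eq_bot] at h
    rw [φ.injective (h.trans (map_zero _).symm), mul_zero]
  | succ M ih =>
    intro s v hs hv
    by_cases hdeg : ∀ i ∈ s, (φ.toAlgHom (v i)).coeff M = 0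
    · refine ih s v (by omega) fun i hi => ?_
      rw [Polynomial.degree_lt_iff_coeff_zero]
      intro j hj
      rcases hj.eq_or_lt with rfl | hj
      · exact hdeg i hi
      · exact (Polynomial.degree_lt_iff_coeff_zero _ _).1 (hv i hi) j hj
    · push Not at hdeg
      obtain ⟨i₀, hi₀, hne⟩ := hdeg
      set u := fun i => (φ.toAlgHom (v i)).coeff M with hu
      have hui : ∀ i ∈ s, u i ∈ φ.invariants := fun i hi => coeff_mem_invariants (hv i hi)
      have hφu : ∀ i ∈ s, φ.toAlgHom (u i) = Polynomial.C (u i) := hui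
      obtain ⟨c, hc, ⟨i₁, hi₁, hci₁⟩, hsum⟩ :=
        ih (s.erase i₀) (fun i => u i₀ * v i - u i * v i₀)
          (by rw [Finset.card_erase_of_mem hi₀]; omega) (by
            intro i hi
            have hi := Finset.mem_of_mem_erase hi
            rw [Polynomial.degree_lt_iff_coeff_zero]
            intro j hj
            rw [map_sub, map_mul, map_mul, hφu i hi, hφu i₀ hi₀, Polynomial.coeff_sub,
              Polynomial.coeff_C_mul, Polynomial.coeff_C_mul]
            rcases hj.eq_or_lt with rfl | hj
            · simp only [hu]; ring
            · rw [(Polynomial.degree_lt_iff_coeff_zero _ _).1 (hv i hi) j hj,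
                (Polynomial.degree_lt_iff_coeff_zero _ _).1 (hv i₀ hi₀) j hj]
              simp)
      refine ⟨fun i => if i = i₀ then -∑ j ∈ s.erase i₀, c j * u j else c i * u i₀, ?_,
        ⟨i₁, Finset.mem_of_mem_erase hi₁, ?_⟩, ?_⟩
      · intro i
        dsimp only
        split_ifs
        · exact neg_mem (sum_mem fun j hj =>
            mul_mem (hc j) (hui j (Finset.mem_of_mem_erase hj)))
        · exact mul_mem (hc i) (hui i₀ hi₀)
      · dsimp only
        rw [if_neg (Finset.ne_of_mem_erase hi₁)]
        exact mul_ne_zero hci₁ hne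
      · dsimp only
        rw [← Finset.add_sum_erase _ _ hi₀, if_pos rfl]
        have hrest : ∑ i ∈ s.erase i₀,
            (if i = i₀ then -∑ j ∈ s.erase i₀, c j * u j else c i * u i₀) * v i =
            ∑ i ∈ s.erase i₀, c i * u i₀ * v i :=
          Finset.sum_congr rfl fun i hi => by rw [if_neg (Finset.ne_of_mem_erase hi)]
        rw [hrest, neg_mul, Finset.sum_mul, neg_add_eq_sub, ← Finset.sum_sub_distrib, ← hsum]
        exact Finset.sum_congr rfl fun i _ => by ring

/-- An element algebraic over the invariants is invariant. -/
theorem mem_invariants_of_algebraic [IsDomain D] (φ : ExpMap k D) {d : D} (s : Finset ℕ)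
    (c : ℕ → D) (hc : ∀ i, c i ∈ φ.invariants) (hne : ∃ i ∈ s, c i ≠ 0)
    (h : ∑ i ∈ s, c i * d ^ i = 0) : d ∈ φ.invariants := by
  have hc' : ∀ i, φ.toAlgHom (c i) = Polynomial.C (c i) := hc
  set q : Polynomial D := ∑ i ∈ s, Polynomial.C (c i) * Polynomial.X ^ i with hq
  have hcomp : q.comp (φ.toAlgHom d) = 0 := by
    have := congrArg φ.toAlgHom h
    rw [map_zero] at this
    rw [← this, hq, ← Polynomial.coe_compRingHom_apply, map_sum, map_sum]
    exact Finset.sum_congr rfl fun i _ => by simp [hc']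
  rw [Polynomial.comp_eq_zero_iff] at hcomp
  rcases hcomp with h0 | ⟨_, h0⟩
  · exfalso
    obtain ⟨i, hi, hne⟩ := hne
    apply hne
    have := congrArg (fun p => Polynomial.coeff p i) h0
    simp only [hq, Polynomial.finsetSum_coeff, Polynomial.coeff_C_mul, Polynomial.coeff_X_pow,
      Polynomial.coeff_zero] at this
    rw [Finset.sum_eq_single i] at this
    · simpa using this
    · intro b _ hb; simp [hb.symm]
    · intro h; exact absurd hi h
  · rw [mem_invariants_iff_natDegree, h0, Polynomial.natDegree_C]

theorem invariants_ne_top_iff_of_adjoin {φ : ExpMap k D} {s : Set D}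
    (hs : Algebra.adjoin k s = ⊤) : φ.invariants ≠ ⊤ ↔ ∃ d ∈ s, d ∉ φ.invariants := by
  rw [← not_iff_not]
  push Not
  constructor
  · intro h d _
    rw [h]; exact Algebra.mem_top
  · intro h
    rw [eq_top_iff, ← hs]
    exact Algebra.adjoin_le h

theorem invariants_le_derksen {φ : ExpMap k D} (h : φ.invariants ≠ ⊤) :
    φ.invariants ≤ Derksen k D := by
  intro d hd
  exact Algebra.subset_adjoin (Set.mem_biUnion (show φ ∈ {ψ : ExpMap k D | ψ.invariants ≠ ⊤}
    from h) hd)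

end General

end ExpMap

/-! ### Leading forms -/

/-- A filtration of an algebra by a linearly ordered group, together with a choice of
homogeneous components which is multiplicative on leading forms. -/
structure LeadingForms (k S Γ : Type) [CommRing k] [CommRing S] [Algebra k S]
    [AddCommGroup Γ] [LinearOrder Γ] where
  fil : Γ → Submodule k S
  gr : Γ → S →ₗ[k] S
  one_mem : 1 ∈ fil 0
  gr_one : gr 0 1 = 1
  mul_mem : ∀ {d d' a b}, a ∈ fil d → b ∈ fil d' → a * b ∈ fil (d + d')
  gr_mul : ∀ {d d' a b}, a ∈ fil d → b ∈ fil d' → gr (d + d') (a * b) = gr d a * gr d' b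
  fil_mono : ∀ {d d'}, d ≤ d' → fil d ≤ fil d'
  gr_of_lt : ∀ {d d' a}, a ∈ fil d → d < d' → gr d' a = 0
  gr_gr : ∀ d a, gr d (gr d a) = gr d a
  gr_mem : ∀ d a, gr d a ∈ fil d
  gr_gr_ne : ∀ {d d'} a, d ≠ d' → gr d (gr d' a) = 0

namespace LeadingForms

section General
variable {k S Γ : Type} [CommRing k] [CommRing S] [Algebra k S] [AddCommGroup Γ] [LinearOrder Γ]
  (lf : LeadingForms k S Γ)

theorem algebraMap_mem (c : k) : algebraMap k S c ∈ lf.fil 0 := by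
  rw [Algebra.algebraMap_eq_smul_one]
  exact Submodule.smul_mem _ _ lf.one_mem

theorem gr_algebraMap (c : k) : lf.gr 0 (algebraMap k S c) = algebraMap k S c := by
  rw [Algebra.algebraMap_eq_smul_one, map_smul, lf.gr_one]

theorem pow_mem {d : Γ} {a : S} (ha : a ∈ lf.fil d) (n : ℕ) : a ^ n ∈ lf.fil (n • d) := by
  induction n with
  | zero => simpa using lf.one_mem
  | succ n ih => rw [pow_succ, succ_nsmul]; exact lf.mul_mem ih ha

theorem gr_pow {d : Γ} {a : S} (ha : a ∈ lf.fil d) (n : ℕ) :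
    lf.gr (n • d) (a ^ n) = lf.gr d a ^ n := by
  induction n with
  | zero => simpa using lf.gr_one
  | succ n ih => rw [pow_succ, succ_nsmul, lf.gr_mul (lf.pow_mem ha n) ha, ih, pow_succ]

theorem prod_mem {ι : Type} (s : Finset ι) {d : ι → Γ} {a : ι → S}
    (ha : ∀ i, a i ∈ lf.fil (d i)) : ∏ i ∈ s, a i ∈ lf.fil (∑ i ∈ s, d i) := by
  classical
  induction s using Finset.induction_on with
  | empty => simpa using lf.one_mem
  | insert i s hi ih =>
    rw [Finset.prod_insert hi, Finset.sum_insert hi]; exact lf.mul_mem (ha i) ih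

theorem gr_prod {ι : Type} (s : Finset ι) {d : ι → Γ} {a : ι → S}
    (ha : ∀ i, a i ∈ lf.fil (d i)) :
    lf.gr (∑ i ∈ s, d i) (∏ i ∈ s, a i) = ∏ i ∈ s, lf.gr (d i) (a i) := by
  classical
  induction s using Finset.induction_on with
  | empty => simpa using lf.gr_one
  | insert i s hi ih =>
    rw [Finset.prod_insert hi, Finset.sum_insert hi, Finset.prod_insert hi,
      lf.gr_mul (ha i) (lf.prod_mem s ha), ih]

end General

section Polynomial
variable {k S Γ : Type} [CommRing k] [CommRing S] [Algebra k S] [AddCommGroup Γ] [LinearOrder Γ]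
  (lf : LeadingForms k S Γ) (θ : Γ)

private theorem coeff_sum_monomial_gr (d : Γ) (q : Polynomial S) (n : ℕ) :
    (q.sum fun n a => Polynomial.monomial n (lf.gr (d + n • θ) a)).coeff n =
      lf.gr (d + n • θ) (q.coeff n) := by
  simp only [Polynomial.sum_def, Polynomial.finsetSum_coeff, Polynomial.coeff_monomial]
  rw [Finset.sum_eq_single n]
  · simp
  · intro b _ hb; simp [hb]
  · intro hn; simp [Polynomial.notMem_support_iff.mp hn]

/-- The coefficientwise component of weight `d` of a polynomial in `U`, where `U` has
weight `-θ`. -/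
def polyGr (d : Γ) : Polynomial S →ₗ[k] Polynomial S where
  toFun q := q.sum fun n a => Polynomial.monomial n (lf.gr (d + n • θ) a)
  map_add' p q := by
    ext n
    simp only [coeff_sum_monomial_gr, Polynomial.coeff_add, map_add]
  map_smul' c q := by
    ext n
    simp only [coeff_sum_monomial_gr, Polynomial.coeff_smul, map_smul, RingHom.id_apply]

theorem coeff_polyGr (d : Γ) (q : Polynomial S) (n : ℕ) :
    (lf.polyGr θ d q).coeff n = lf.gr (d + n • θ) (q.coeff n) :=
  lf.coeff_sum_monomial_gr θ d q n

variable [IsOrderedAddMonoid Γ]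

/-- The leading form structure on `S[U]` for which `U` has weight `-θ`. -/
def poly : LeadingForms k (Polynomial S) Γ where
  fil d :=
    { carrier := {q | ∀ n : ℕ, q.coeff n ∈ lf.fil (d + n • θ)}
      zero_mem' := fun n => by simp
      add_mem' := fun ha hb n => by
        rw [Polynomial.coeff_add]; exact add_mem (ha n) (hb n)
      smul_mem' := fun c q hq n => by
        rw [Polynomial.coeff_smul]; exact Submodule.smul_mem _ _ (hq n) }
  gr := lf.polyGr θ
  one_mem n := by
    rw [Polynomial.coeff_one]
    split_ifs with h
    · subst h; simpa using lf.one_mem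
    · exact zero_mem _
  gr_one := by
    ext n
    rw [coeff_polyGr, Polynomial.coeff_one]
    split_ifs with h
    · subst h; simpa using lf.gr_one
    · simp
  mul_mem {d d' a b} ha hb n := by
    rw [Polynomial.coeff_mul]
    refine sum_mem fun p hp => ?_
    rw [Finset.HasAntidiagonal.mem_antidiagonal] at hp
    have := lf.mul_mem (ha p.1) (hb p.2)
    rwa [← hp, add_nsmul, add_add_add_comm]
  gr_mul {d d' a b} ha hb := by
    ext n
    rw [coeff_polyGr, Polynomial.coeff_mul, Polynomial.coeff_mul, map_sum]
    refine Finset.sum_congr rfl fun p hp => ?_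
    rw [Finset.HasAntidiagonal.mem_antidiagonal] at hp
    rw [coeff_polyGr, coeff_polyGr, ← lf.gr_mul (ha p.1) (hb p.2), ← hp, add_nsmul,
      add_add_add_comm]
  fil_mono h q hq n := lf.fil_mono (by gcongr) (hq n)
  gr_of_lt {d d' a} ha h := by
    ext n
    rw [coeff_polyGr, lf.gr_of_lt (ha n) (by gcongr), Polynomial.coeff_zero]
  gr_gr d q := by
    ext n
    rw [coeff_polyGr, coeff_polyGr, lf.gr_gr]
  gr_mem d q n := by
    rw [coeff_polyGr]; exact lf.gr_mem _ _
  gr_gr_ne q h := by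
    ext n
    rw [coeff_polyGr, coeff_polyGr, lf.gr_gr_ne _ (by simpa using h), Polynomial.coeff_zero]

theorem coeff_poly_gr (d : Γ) (q : Polynomial S) (n : ℕ) :
    ((lf.poly θ).gr d q).coeff n = lf.gr (d + n • θ) (q.coeff n) := lf.coeff_polyGr θ d q n

end Polynomial

section Laurent
variable {k R G Γ : Type} [CommRing k] [CommRing R] [Algebra k R] [AddCommGroup G]
  [AddCommGroup Γ] [LinearOrder Γ] (lam : G →+ Γ)

omit [AddCommGroup G] in
theorem eq_sum_single (h : AddMonoidAlgebra R G) :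
    h = ∑ e ∈ h.coeff.support, AddMonoidAlgebra.single e (h.coeff e) :=
  h.sum_coeff_single.symm

open Classical in
/-- The component of weight `d` of an element of a group algebra. -/
def laurentGr (d : Γ) : AddMonoidAlgebra R G →ₗ[k] AddMonoidAlgebra R G where
  toFun h := AddMonoidAlgebra.ofCoeff (h.coeff.filter fun e => lam e = d)
  map_add' a b := by ext e; simp [Finsupp.filter_apply]
  map_smul' c a := by
    ext e : 2
    simp only [Finsupp.filter_apply, AddMonoidAlgebra.coeff_smul, Finsupp.smul_apply,
      RingHom.id_apply]
    split_ifs <;> simp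

open Classical in
theorem coeff_laurentGr (d : Γ) (h : AddMonoidAlgebra R G) (e : G) :
    (laurentGr (k := k) lam d h).coeff e = if lam e = d then h.coeff e else 0 :=
  Finsupp.filter_apply _ _ _

open Classical in
theorem laurentGr_single (d : Γ) (e : G) (c : R) :
    laurentGr (k := k) lam d (AddMonoidAlgebra.single e c) =
      if lam e = d then AddMonoidAlgebra.single e c else 0 := by
  ext e' : 2
  rw [coeff_laurentGr, AddMonoidAlgebra.coeff_single, Finsupp.single_apply]
  by_cases h : e = e'
  · subst h
    split_ifs <;> simp_all
  · rw [if_neg h, ite_self]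
    split_ifs <;> simp [h]

variable [IsOrderedAddMonoid Γ]

/-- The leading form structure on a group algebra given by a weight function. -/
def laurent : LeadingForms k (AddMonoidAlgebra R G) Γ where
  fil d :=
    { carrier := {h | ∀ e, h.coeff e ≠ 0 → lam e ≤ d}
      zero_mem' := fun e he => by simp at he
      add_mem' := fun {a b} ha hb e he => by
        by_contra hlt
        have h1 : a.coeff e = 0 := by_contra fun h => hlt (ha e h)
        have h2 : b.coeff e = 0 := by_contra fun h => hlt (hb e h)
        simp [h1, h2] at he
      smul_mem' := fun c q hq e he => hq e fun h => he (by simp [h]) }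
  gr := laurentGr lam
  one_mem e he := by
    classical
    by_contra h
    apply he
    rw [AddMonoidAlgebra.one_def, AddMonoidAlgebra.coeff_single, Finsupp.single_apply, if_neg]
    rintro rfl
    simp at h
  gr_one := by
    rw [AddMonoidAlgebra.one_def, laurentGr_single, if_pos (map_zero lam)]
  mul_mem {d d' a b} ha hb e he := by
    classical
    rw [AddMonoidAlgebra.coeff_mul, Finsupp.sum] at he
    obtain ⟨e₁, h₁, he⟩ := Finset.exists_ne_zero_of_sum_ne_zero he
    obtain ⟨e₂, h₂, he⟩ := Finset.exists_ne_zero_of_sum_ne_zero he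
    have : e₁ + e₂ = e := by_contra fun h => he (if_neg h)
    rw [← this, map_add]
    exact add_le_add (ha e₁ (Finsupp.mem_support_iff.1 h₁)) (hb e₂ (Finsupp.mem_support_iff.1 h₂))
  gr_mul {d d' a b} ha hb := by
    have hle : ∀ e ∈ a.coeff.support, lam e ≤ d := fun e he => ha e (Finsupp.mem_support_iff.1 he)
    have hle' : ∀ e ∈ b.coeff.support, lam e ≤ d' :=
      fun e he => hb e (Finsupp.mem_support_iff.1 he)
    rw [eq_sum_single a, eq_sum_single b]
    simp only [Finset.sum_mul_sum, map_sum]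
    refine Finset.sum_congr rfl fun e he => Finset.sum_congr rfl fun e' he' => ?_
    rw [AddMonoidAlgebra.single_mul_single, laurentGr_single, laurentGr_single, laurentGr_single,
      map_add]
    have h := hle e he
    have h' := hle' e' he'
    by_cases h1 : lam e = d
    · by_cases h2 : lam e' = d'
      · rw [if_pos h1, if_pos h2, if_pos (by rw [h1, h2]), AddMonoidAlgebra.single_mul_single]
      · rw [if_neg h2, if_neg (by simpa [h1] using h2), mul_zero]
    · rw [if_neg h1, if_neg (add_lt_add_of_lt_of_le (lt_of_le_of_ne h h1) h').ne, zero_mul]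
  fil_mono h a ha e he := (ha e he).trans h
  gr_of_lt {d d' a} ha h := by
    ext e : 2
    rw [coeff_laurentGr]
    split_ifs with he
    · by_contra hne
      exact absurd (ha e hne) (by rw [he]; exact not_le.mpr h)
    · rfl
  gr_gr d a := by
    ext e : 2
    simp only [coeff_laurentGr]
    split_ifs <;> rfl
  gr_mem d a e he := by
    by_contra h
    apply he
    rw [coeff_laurentGr]
    exact if_neg fun h' => h h'.le
  gr_gr_ne {d d'} a h := by
    ext e : 2
    simp only [coeff_laurentGr]
    split_ifs with h1 h2
    · exact absurd (h1.symm.trans h2) h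
    · rfl
    · rfl

open Classical in
theorem coeff_laurent_gr (d : Γ) (h : AddMonoidAlgebra R G) (e : G) :
    ((laurent (k := k) lam).gr d h).coeff e = if lam e = d then h.coeff e else 0 :=
  coeff_laurentGr lam d h e

open Classical in
theorem laurent_gr_single (d : Γ) (e : G) (c : R) :
    (laurent (k := k) lam).gr d (AddMonoidAlgebra.single e c) =
      if lam e = d then AddMonoidAlgebra.single e c else 0 :=
  laurentGr_single lam d e c

end Laurent

end LeadingForms

/-! ### Normal forms -/

section NormalForm
variable {k : Type} [Field k] {m : ℕ} (r : Fin m → ℕ)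

/-- The exponent of `Y` in the normal form of a Laurent monomial. -/
def bexp (e : Fin m → ℤ) : ℕ := sInf {b : ℕ | ∀ i, 0 ≤ e i + b * r i}

/-- The exponents of the `X i` in the normal form of a Laurent monomial. -/
def aexp (e : Fin m → ℤ) (i : Fin m) : ℕ := (e i + bexp r e * r i).toNat

variable {r}

theorem bexp_le {e : Fin m → ℤ} {b : ℕ} (h : ∀ i, 0 ≤ e i + b * r i) : bexp r e ≤ b :=
  Nat.sInf_le h

theorem bexp_spec (hr : ∀ i, 1 < r i) (e : Fin m → ℤ) (i : Fin m) :
    0 ≤ e i + bexp r e * r i := by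
  have hne : {b : ℕ | ∀ i, 0 ≤ e i + b * r i}.Nonempty := by
    refine ⟨∑ i, (e i).natAbs, fun i => ?_⟩
    have h1 : (e i).natAbs ≤ ∑ i, (e i).natAbs :=
      Finset.single_le_sum (f := fun i => (e i).natAbs) (fun _ _ => Nat.zero_le _)
        (Finset.mem_univ i)
    have h2 : (∑ i, (e i).natAbs) * 1 ≤ (∑ i, (e i).natAbs) * r i :=
      Nat.mul_le_mul_left _ (hr i).le
    have h3 : ((e i).natAbs : ℤ) ≤ ((∑ i, (e i).natAbs : ℕ) : ℤ) * r i := by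
      exact_mod_cast h1.trans (by simpa using h2)
    omega
  exact Nat.sInf_mem hne i

theorem aexp_cast (hr : ∀ i, 1 < r i) (e : Fin m → ℤ) (i : Fin m) :
    (aexp r e i : ℤ) = e i + bexp r e * r i :=
  Int.toNat_of_nonneg (bexp_spec hr e i)

theorem bexp_eq_zero (hr : ∀ i, 1 < r i) {e : Fin m → ℤ} :
    bexp r e = 0 ↔ ∀ i, 0 ≤ e i := by
  constructor
  · intro h i
    simpa [h] using bexp_spec hr e i
  · intro h
    exact Nat.le_zero.1 (bexp_le (by simpa using h))

theorem bexp_smul_add_aexp (hr : ∀ i, 1 < r i) (e : Fin m → ℤ) :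
    (∑ i, aexp r e i • Pi.single i (1 : ℤ)) + bexp r e • (fun i => -(r i : ℤ)) = e := by
  ext j
  have := aexp_cast hr e j
  have h1 : (∑ i, aexp r e i • Pi.single i (1 : ℤ)) j = aexp r e j := by
    rw [Finset.sum_apply]
    simp [Pi.single_apply]
  rw [Pi.add_apply, h1, this, Pi.smul_apply, nsmul_eq_mul]
  ring

variable (k r)

/-- The inclusion `k[Z,T] → k[X_1,…,X_m,Y,Z,T]`. -/
def inclR : MvPolynomial (Fin 2) k →ₐ[k] BigP k m := rename fun j => Sum.inr j.succ

/-- The normal form monomial attached to a Laurent monomial. -/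
def normMon (e : Fin m → ℤ) : BigP k m :=
  (∏ i, X (Sum.inl i) ^ aexp r e i) * X (Sum.inr 0) ^ bexp r e

/-- The normal form `∑ c_e(Z,T) X^a Y^b`. -/
def normForm : ((Fin m → ℤ) →₀ MvPolynomial (Fin 2) k) →ₗ[k] BigP k m :=
  Finsupp.lsum k fun e => (LinearMap.mulRight k (normMon k r e)) ∘ₗ (inclR k).toLinearMap

variable {k r}

theorem normForm_single (e : Fin m → ℤ) (q : MvPolynomial (Fin 2) k) :
    normForm k r (Finsupp.single e q) = inclR k q * normMon k r e := by
  simp [normForm]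

theorem normForm_eq_sum (c : (Fin m → ℤ) →₀ MvPolynomial (Fin 2) k) :
    normForm k r c = ∑ e ∈ c.support, inclR k (c e) * normMon k r e := by
  simp [normForm, Finsupp.sum]

theorem monomial_eq_inclR_mul (s : Fin m ⊕ Fin 3 →₀ ℕ) (c : k) :
    (monomial s c : BigP k m) =
      inclR k (C c * X 0 ^ s (Sum.inr 1) * X 1 ^ s (Sum.inr 2)) *
        (∏ i, X (Sum.inl i) ^ s (Sum.inl i)) * X (Sum.inr 0) ^ s (Sum.inr 0) := by
  rw [monomial_eq, Finsupp.prod_fintype _ _ (by simp), Fintype.prod_sum_type, Fin.prod_univ_three]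
  simp only [inclR, map_mul, map_pow, rename_X, rename_C]
  simp only [Fin.succ_zero_eq_one, Fin.succ_one_eq_two]
  ring

theorem incl_monomial_eq_inclR_mul (s : Fin m ⊕ Fin 2 →₀ ℕ) (c : k) :
    incl k m (monomial s c) =
      inclR k (C c * X 0 ^ s (Sum.inr 0) * X 1 ^ s (Sum.inr 1)) *
        (∏ i, X (Sum.inl i) ^ s (Sum.inl i)) := by
  rw [monomial_eq, Finsupp.prod_fintype _ _ (by simp), Fintype.prod_sum_type, Fin.prod_univ_two]
  simp only [inclR, incl, map_mul, map_pow, map_prod, rename_X, rename_C, Sum.map_inl, Sum.map_inr,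
    id]
  ring

/-- Every element of `A` has a normal form. -/
theorem exists_normForm (hr : ∀ i, 1 < r i) (F : MvPolynomial (Fin m ⊕ Fin 2) k) (P : BigP k m) :
    ∃ c, (Ideal.Quotient.mk (Ideal.span {relG k m r F})) P =
      Ideal.Quotient.mk (Ideal.span {relG k m r F}) (normForm k r c) := by
  set π := (Ideal.Quotient.mkₐ k (Ideal.span {relG k m r F})).toLinearMap with hπ
  set W : Submodule k (BigP k m) := (LinearMap.range (π ∘ₗ normForm k r)).comap π with hW
  have key : ∀ b (a : Fin m → ℕ) (q : MvPolynomial (Fin 2) k),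
      inclR k q * (∏ i, X (Sum.inl i) ^ a i) * X (Sum.inr 0) ^ b ∈ W := by
    intro b
    induction b with
    | zero =>
      intro a q
      have hb : bexp r (fun i => (a i : ℤ)) = 0 := (bexp_eq_zero hr).2 fun i => by simp
      refine ⟨Finsupp.single (fun i => (a i : ℤ)) q, ?_⟩
      rw [LinearMap.comp_apply, normForm_single]
      simp [normMon, aexp, hb]
    | succ b ih =>
      intro a q
      have ih' : ∀ G, incl k m G * X (Sum.inr 0) ^ b ∈ W := by
        intro G
        induction G using MvPolynomial.induction_on' with
        | monomial s c => rw [incl_monomial_eq_inclR_mul]; exact ih _ _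
        | add p q hp hq => rw [map_add, add_mul]; exact add_mem hp hq
      by_cases hb : ∀ i, r i ≤ a i
      · have h1 : inclR k q * (∏ i, X (Sum.inl i) ^ a i) * X (Sum.inr 0) ^ (b + 1) =
            inclR k q * (∏ i, X (Sum.inl i) ^ (a i - r i)) * X (Sum.inr 0) ^ b * relG k m r F +
            incl k m (rename Sum.inr q * (∏ i, X (Sum.inl i) ^ (a i - r i)) * F) *
              X (Sum.inr 0) ^ b := by
          have h2 : (∏ i, (X (Sum.inl i) : BigP k m) ^ a i) =
              (∏ i, X (Sum.inl i) ^ (a i - r i)) * ∏ i, X (Sum.inl i) ^ r i := by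
            rw [← Finset.prod_mul_distrib]
            exact Finset.prod_congr rfl fun i _ => by rw [← pow_add, Nat.sub_add_cancel (hb i)]
          have h3 : incl k m (rename Sum.inr q) = inclR k q := by
            rw [incl, inclR, rename_rename]; rfl
          have h4 : incl k m (∏ i, X (Sum.inl i) ^ (a i - r i)) =
              ∏ i, X (Sum.inl i) ^ (a i - r i) := by
            simp [incl, map_prod]
          rw [map_mul, map_mul, h3, h4, h2, relG]
          ring
        rw [h1]
        refine add_mem ?_ (ih' _)
        have : π (inclR k q * (∏ i, X (Sum.inl i) ^ (a i - r i)) * X (Sum.inr 0) ^ b *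
            relG k m r F) = 0 :=
          Ideal.Quotient.eq_zero_iff_mem.2
            (Ideal.mul_mem_left _ _ (Ideal.subset_span (Set.mem_singleton _)))
        rw [hW, Submodule.mem_comap, this]
        exact zero_mem _
      · set e : Fin m → ℤ := fun i => (a i : ℤ) - (b + 1 : ℕ) * r i with he
        have h1 : bexp r e = b + 1 := by
          refine le_antisymm (bexp_le fun i => by simp [he]) (not_lt.1 fun hlt => hb fun i => ?_)
          have h2 := bexp_spec hr e i
          have h3 : (bexp r e : ℤ) * r i ≤ b * r i := by
            exact_mod_cast Nat.mul_le_mul_right _ (Nat.lt_succ_iff.1 hlt)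
          have h4 : e i = (a i : ℤ) - (b + 1) * r i := by simp [he]
          rw [h4] at h2
          have : (r i : ℤ) ≤ a i := by linarith
          exact_mod_cast this
        refine ⟨Finsupp.single e q, ?_⟩
        rw [LinearMap.comp_apply, normForm_single, normMon, h1, mul_assoc]
        have h2 : ∀ i, aexp r e i = a i := fun i => by
          rw [aexp, h1]; simp [he]
        simp only [h2]
  have hP : P ∈ W := by
    induction P using MvPolynomial.induction_on' with
    | monomial s c => rw [monomial_eq_inclR_mul]; exact key _ _ _
    | add p q hp hq => exact add_mem hp hq
  obtain ⟨c, hc⟩ := hP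
  exact ⟨c, hc.symm⟩

end NormalForm

/-! ### Leading forms of homomorphisms -/

section LeadingHom
variable {k : Type} [Field k] {m : ℕ} {r : Fin m → ℕ} {Γ : Type} [AddCommGroup Γ]

section
variable (lam : (Fin m → ℤ) →+ Γ) (r)

/-- The weights of the variables `X_i`, `Y`, `Z`, `T`. -/
def weight : Fin m ⊕ Fin 3 → Γ :=
  Sum.elim (fun i => lam (Pi.single i 1)) (Fin.cons (lam fun i => -(r i : ℤ)) fun _ => 0)

variable {r lam}

@[simp] theorem weight_inl (i : Fin m) : weight r lam (Sum.inl i) = lam (Pi.single i 1) := rfl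
@[simp] theorem weight_Y : weight r lam (Sum.inr 0) = lam fun i => -(r i : ℤ) := rfl
@[simp] theorem weight_succ (j : Fin 2) : weight r lam (Sum.inr j.succ) = 0 := rfl

theorem lam_eq (hr : ∀ i, 1 < r i) (e : Fin m → ℤ) :
    (∑ i, aexp r e i • weight r lam (Sum.inl i)) + bexp r e • weight r lam (Sum.inr 0) = lam e := by
  conv_rhs => rw [← bexp_smul_add_aexp hr e]
  simp only [map_add, map_sum, map_nsmul, weight_inl, weight_Y]

end

variable [LinearOrder Γ] {S : Type} [CommRing S] [Algebra k S]

theorem LeadingForms.gr_zero_algHom (lf : LeadingForms k S Γ) {τ : Type}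
    (γ γ' : MvPolynomial τ k →ₐ[k] S)
    (h : ∀ s, γ (X s) ∈ lf.fil 0 ∧ lf.gr 0 (γ (X s)) = γ' (X s)) (q : MvPolynomial τ k) :
    γ q ∈ lf.fil 0 ∧ lf.gr 0 (γ q) = γ' q := by
  induction q using MvPolynomial.induction_on with
  | C c =>
    rw [← algebraMap_eq, AlgHom.commutes, AlgHom.commutes]
    exact ⟨lf.algebraMap_mem c, lf.gr_algebraMap c⟩
  | add p q hp hq =>
    simp only [map_add]
    exact ⟨add_mem hp.1 hq.1, by rw [hp.2, hq.2]⟩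
  | mul_X p s hp =>
    simp only [map_mul]
    have h1 := lf.mul_mem hp.1 (h s).1
    have h2 := lf.gr_mul hp.1 (h s).1
    rw [add_zero] at h1 h2
    exact ⟨h1, by rw [h2, hp.2, (h s).2]⟩

variable {lam : (Fin m → ℤ) →+ Γ}

variable (lam) in
/-- The part of weight `d` of a normal form. -/
def component (d : Γ) (c : (Fin m → ℤ) →₀ MvPolynomial (Fin 2) k) :
    (Fin m → ℤ) →₀ MvPolynomial (Fin 2) k := c.filter fun e => lam e = d

theorem normForm_component (d : Γ) (c : (Fin m → ℤ) →₀ MvPolynomial (Fin 2) k) :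
    normForm k r (component lam d c) =
      ∑ e ∈ c.support, if lam e = d then inclR k (c e) * normMon k r e else 0 := by
  rw [normForm_eq_sum, component, Finsupp.support_filter, Finset.sum_filter]
  refine Finset.sum_congr rfl fun e _ => ?_
  split_ifs with h
  · rw [Finsupp.filter_apply_pos (fun e => lam e = d) _ h]
  · rfl

variable (lam) in
/-- The data of a homomorphism `α` compatible with the weights and its leading form `α'`. -/
structure IsLeadingHom (lf : LeadingForms k S Γ) (r : Fin m → ℕ) (α α' : BigP k m →ₐ[k] S) :
    Prop where
  neg : ∀ i, lam (Pi.single i 1) < 0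
  one_lt : ∀ i, 1 < r i
  mem : ∀ s, α (X s) ∈ lf.fil (weight r lam s)
  gr : ∀ s, lf.gr (weight r lam s) (α (X s)) = α' (X s)

/-- The polynomial `f(Z,T)`, viewed as a polynomial in `X_1,…,X_m,Z,T`. -/
def leadF (F : MvPolynomial (Fin m ⊕ Fin 2) k) : MvPolynomial (Fin m ⊕ Fin 2) k :=
  rename Sum.inr (fOf k m F)

theorem incl_leadF (F : MvPolynomial (Fin m ⊕ Fin 2) k) :
    incl k m (leadF F) = inclR k (fOf k m F) := by
  rw [incl, leadF, inclR, rename_rename]; rfl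

theorem fOf_leadF (F : MvPolynomial (Fin m ⊕ Fin 2) k) : fOf k m (leadF F) = fOf k m F := by
  conv_lhs => rw [fOf, leadF, aeval_rename]
  simp [Function.comp_def]

namespace IsLeadingHom
variable {lf : LeadingForms k S Γ} {α α' : BigP k m →ₐ[k] S}
  (h : IsLeadingHom lam lf r α α')
include h

theorem inclR_aux (q : MvPolynomial (Fin 2) k) :
    α (inclR k q) ∈ lf.fil 0 ∧ lf.gr 0 (α (inclR k q)) = α' (inclR k q) := by
  refine lf.gr_zero_algHom (α.comp (inclR k)) (α'.comp (inclR k)) (fun j => ?_) q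
  have h1 := h.mem (Sum.inr j.succ)
  have h2 := h.gr (Sum.inr j.succ)
  rw [weight_succ] at h1 h2
  simpa [inclR] using ⟨h1, h2⟩

theorem monomial_aux (a : Fin m → ℕ) (b : ℕ) :
    α ((∏ i, X (Sum.inl i) ^ a i) * X (Sum.inr 0) ^ b) ∈
      lf.fil ((∑ i, a i • weight r lam (Sum.inl i)) + b • weight r lam (Sum.inr 0)) ∧
    lf.gr ((∑ i, a i • weight r lam (Sum.inl i)) + b • weight r lam (Sum.inr 0))
      (α ((∏ i, X (Sum.inl i) ^ a i) * X (Sum.inr 0) ^ b)) =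
      α' ((∏ i, X (Sum.inl i) ^ a i) * X (Sum.inr 0) ^ b) := by
  simp only [map_mul, map_prod, map_pow]
  have h1 : ∀ i, α (X (Sum.inl i)) ^ a i ∈ lf.fil (a i • weight r lam (Sum.inl i)) :=
    fun i => lf.pow_mem (h.mem _) _
  have h2 := lf.prod_mem Finset.univ h1
  have h3 := lf.pow_mem (h.mem (Sum.inr 0)) b
  refine ⟨lf.mul_mem h2 h3, ?_⟩
  rw [lf.gr_mul h2 h3, lf.gr_prod Finset.univ h1, lf.gr_pow (h.mem _), h.gr]
  simp only [lf.gr_pow (h.mem _), h.gr]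

theorem term_aux (e : Fin m → ℤ) (q : MvPolynomial (Fin 2) k) :
    α (inclR k q * normMon k r e) ∈ lf.fil (lam e) ∧
      lf.gr (lam e) (α (inclR k q * normMon k r e)) = α' (inclR k q * normMon k r e) := by
  have h1 := h.inclR_aux q
  have h2 := h.monomial_aux (aexp r e) (bexp r e)
  rw [lam_eq h.one_lt] at h2
  have h3 := lf.mul_mem h1.1 h2.1
  have h4 := lf.gr_mul h1.1 h2.1
  rw [zero_add] at h3 h4
  rw [map_mul α, map_mul α']
  exact ⟨h3, h4.trans (by rw [h1.2, h2.2]; rfl)⟩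

theorem gr_normForm {c : (Fin m → ℤ) →₀ MvPolynomial (Fin 2) k} {d : Γ}
    (hc : ∀ e ∈ c.support, lam e ≤ d) :
    lf.gr d (α (normForm k r c)) = α' (normForm k r (component lam d c)) := by
  rw [normForm_component, normForm_eq_sum, map_sum, map_sum, map_sum]
  refine Finset.sum_congr rfl fun e he => ?_
  split_ifs with hd
  · rw [← hd]; exact (h.term_aux e (c e)).2
  · rw [map_zero]
    exact lf.gr_of_lt (h.term_aux e (c e)).1 (lt_of_le_of_ne (hc e he) hd)

theorem gr_normForm_lead (c : (Fin m → ℤ) →₀ MvPolynomial (Fin 2) k) (d : Γ) :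
    lf.gr d (α' (normForm k r c)) = α' (normForm k r (component lam d c)) := by
  rw [normForm_component, normForm_eq_sum, map_sum, map_sum, map_sum]
  refine Finset.sum_congr rfl fun e he => ?_
  rw [← (h.term_aux e (c e)).2]
  split_ifs with hd
  · rw [← hd, lf.gr_gr]; exact (h.term_aux e (c e)).2
  · rw [map_zero]
    exact lf.gr_gr_ne _ (Ne.symm hd)

theorem gr_zero_incl [IsOrderedAddMonoid Γ] (F : MvPolynomial (Fin m ⊕ Fin 2) k) :
    lf.gr 0 (α (incl k m F)) = α' (inclR k (fOf k m F)) := by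
  have h1 := (lf.gr_zero_algHom (α.comp (incl k m))
    ((α'.comp (inclR k)).comp (aeval (Sum.elim (fun _ => (0 : MvPolynomial (Fin 2) k)) X)))
    (fun s => ?_) F).2
  · exact h1
  · cases s with
    | inl i =>
      have h2 := h.mem (Sum.inl i)
      rw [weight_inl] at h2
      simp only [AlgHom.comp_apply, incl, rename_X, Sum.map_inl, id, aeval_X, Sum.elim_inl, map_zero]
      exact ⟨lf.fil_mono (h.neg i).le h2, lf.gr_of_lt h2 (h.neg i)⟩
    | inr j =>
      have h1 := h.mem (Sum.inr j.succ)
      have h2 := h.gr (Sum.inr j.succ)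
      rw [weight_succ] at h1 h2
      simpa [inclR, incl] using ⟨h1, h2⟩

theorem relG_lead [IsOrderedAddMonoid Γ] {F : MvPolynomial (Fin m ⊕ Fin 2) k}
    (hF : α (relG k m r F) = 0) : α' (relG k m r (leadF F)) = 0 := by
  have h1 := (h.monomial_aux r 1).2
  have h2 : (∑ i, r i • weight r lam (Sum.inl i)) + 1 • weight r lam (Sum.inr 0) = 0 := by
    simp only [weight_inl, weight_Y, ← map_nsmul, ← map_sum, ← map_add]
    convert map_zero lam
    ext j
    simp [Finset.sum_apply, Pi.single_apply]
  rw [h2, pow_one] at h1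
  rw [relG, map_sub, sub_eq_zero] at hF ⊢
  rw [← h1, hF, h.gr_zero_incl, incl_leadF]

end IsLeadingHom

end LeadingHom

/-! ### The embedding into a Laurent polynomial ring -/

section Embedding
variable {k : Type} [Field k] {m : ℕ} {r : Fin m → ℕ}

/-- The Laurent polynomial ring `k[Z,T][X_1^{±1},…,X_m^{±1}]`. -/
abbrev Laur (k : Type) [Field k] (m : ℕ) := AddMonoidAlgebra (MvPolynomial (Fin 2) k) (Fin m → ℤ)

/-- The inclusion of `k[X_1,…,X_m,Z,T]` in the Laurent polynomial ring. -/
def toLaur : MvPolynomial (Fin m ⊕ Fin 2) k →ₐ[k] Laur k m :=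
  aeval (Sum.elim (fun i => AddMonoidAlgebra.single (Pi.single i 1) 1)
    fun j => AddMonoidAlgebra.single 0 (X j))

variable (r) in
/-- The homomorphism to the Laurent polynomial ring with `Y ↦ X^{-r} F`. -/
def embed (F : MvPolynomial (Fin m ⊕ Fin 2) k) : BigP k m →ₐ[k] Laur k m :=
  aeval (Sum.elim (fun i => AddMonoidAlgebra.single (Pi.single i 1) 1)
    (Fin.cons (AddMonoidAlgebra.single (fun i => -(r i : ℤ)) 1 * toLaur F)
      fun j => AddMonoidAlgebra.single 0 (X j)))

variable (F : MvPolynomial (Fin m ⊕ Fin 2) k)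

@[simp] theorem embed_inl (i : Fin m) :
    embed r F (X (Sum.inl i)) = AddMonoidAlgebra.single (Pi.single i 1) 1 := by
  simp [embed]

@[simp] theorem embed_Y : embed r F (X (Sum.inr 0)) =
    AddMonoidAlgebra.single (fun i => -(r i : ℤ)) 1 * toLaur F := by
  simp [embed]

@[simp] theorem embed_succ (j : Fin 2) :
    embed r F (X (Sum.inr j.succ)) = AddMonoidAlgebra.single 0 (X j) := by
  rw [embed, aeval_X]; rfl

theorem embed_incl (G : MvPolynomial (Fin m ⊕ Fin 2) k) : embed r F (incl k m G) = toLaur G := by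
  have : (embed r F).comp (incl k m) = toLaur := by
    apply MvPolynomial.algHom_ext
    rintro (i | j)
    · simp [incl, toLaur]
    · simp [incl, toLaur]
  exact DFunLike.congr_fun this G

theorem embed_inclR (q : MvPolynomial (Fin 2) k) :
    embed r F (inclR k q) = AddMonoidAlgebra.single 0 q := by
  have : (embed r F).comp (inclR k) =
      (AddMonoidAlgebra.singleZeroAlgHom : MvPolynomial (Fin 2) k →ₐ[k] Laur k m) := by
    apply MvPolynomial.algHom_ext
    intro j
    simp [inclR]
  exact DFunLike.congr_fun this q

theorem embed_prod (a : Fin m → ℕ) :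
    embed r F (∏ i, X (Sum.inl i) ^ a i) = AddMonoidAlgebra.single (fun i => (a i : ℤ)) 1 := by
  rw [map_prod]
  simp only [map_pow, embed_inl, AddMonoidAlgebra.single_pow, one_pow]
  have : ∀ s : Finset (Fin m), ∏ i ∈ s, (AddMonoidAlgebra.single (a i • Pi.single i (1 : ℤ)) 1 :
      Laur k m) = AddMonoidAlgebra.single (∑ i ∈ s, a i • Pi.single i (1 : ℤ)) 1 := by
    intro s
    induction s using Finset.induction_on with
    | empty => simp [AddMonoidAlgebra.one_def]
    | insert i s hi ih =>
      rw [Finset.prod_insert hi, Finset.sum_insert hi, ih, AddMonoidAlgebra.single_mul_single,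
        one_mul]
  rw [this]
  congr 1
  ext j
  simp [Finset.sum_apply, Pi.single_apply]

theorem embed_relG : embed r F (relG k m r F) = 0 := by
  rw [relG, map_sub, map_mul, embed_prod, embed_Y, embed_incl, ← mul_assoc,
    AddMonoidAlgebra.single_mul_single, mul_one]
  have : ((fun i => (r i : ℤ)) + fun i => -(r i : ℤ)) = 0 := by ext i; simp
  rw [this, ← AddMonoidAlgebra.one_def, one_mul, sub_self]

theorem embed_lead_normMon (hr : ∀ i, 1 < r i) (e : Fin m → ℤ) :
    embed r (leadF F) (normMon k r e) = AddMonoidAlgebra.single e (fOf k m F ^ bexp r e) := by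
  rw [normMon, map_mul, embed_prod, map_pow, embed_Y, ← embed_incl (r := r) (leadF F), incl_leadF,
    embed_inclR, AddMonoidAlgebra.single_mul_single, AddMonoidAlgebra.single_pow,
    AddMonoidAlgebra.single_mul_single]
  rw [one_mul, one_mul, add_zero]
  congr 1
  ext i
  have := aexp_cast hr e i
  rw [Pi.add_apply, this, Pi.smul_apply, nsmul_eq_mul]
  ring

theorem coeff_embed_lead_normForm (hr : ∀ i, 1 < r i)
    (c : (Fin m → ℤ) →₀ MvPolynomial (Fin 2) k) (e : Fin m → ℤ) :
    (embed r (leadF F) (normForm k r c)).coeff e = c e * fOf k m F ^ bexp r e := by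
  classical
  induction c using Finsupp.induction_linear with
  | zero => simp
  | add p q hp hq => rw [map_add, map_add, AddMonoidAlgebra.coeff_add, Finsupp.add_apply, hp, hq,
      Finsupp.add_apply, add_mul]
  | single e' q =>
    rw [normForm_single, map_mul, embed_inclR, embed_lead_normMon F hr,
      AddMonoidAlgebra.single_mul_single, zero_add, AddMonoidAlgebra.coeff_single,
      Finsupp.single_apply, Finsupp.single_apply]
    split_ifs with h
    · rw [h]
    · rw [zero_mul]

variable {Γ : Type} [AddCommGroup Γ] [LinearOrder Γ] [IsOrderedAddMonoid Γ]
  {lam : (Fin m → ℤ) →+ Γ}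

theorem embed_isLeadingHom (hr : ∀ i, 1 < r i) (hlam : ∀ i, lam (Pi.single i 1) < 0) :
    IsLeadingHom lam (LeadingForms.laurent lam) r (embed r F) (embed r (leadF F)) := by
  classical
  have hmem : ∀ (e : Fin m → ℤ) q,
      (AddMonoidAlgebra.single e q : Laur k m) ∈ (LeadingForms.laurent (k := k) lam).fil (lam e) := by
    intro e q e' he'
    rw [AddMonoidAlgebra.coeff_single, Finsupp.single_apply] at he'
    rw [of_not_not fun h => he' (if_neg h)]
  have hgr : ∀ (e : Fin m → ℤ) q,
      (LeadingForms.laurent (k := k) lam).gr (lam e) (AddMonoidAlgebra.single e q : Laur k m) =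
        AddMonoidAlgebra.single e q := by
    intro e q
    rw [LeadingForms.laurent_gr_single, if_pos rfl]
  have hzero : toLaur F ∈ (LeadingForms.laurent (k := k) lam).fil 0 ∧
      (LeadingForms.laurent (k := k) lam).gr 0 (toLaur F) = toLaur (leadF F) := by
    have := LeadingForms.gr_zero_algHom (LeadingForms.laurent (k := k) lam) (toLaur (m := m))
      ((toLaur (m := m)).comp ((rename Sum.inr).comp
        (aeval (Sum.elim (fun _ => (0 : MvPolynomial (Fin 2) k)) X)))) (fun s => ?_) F
    · exact this
    · cases s with
      | inl i =>
        simp only [toLaur, AlgHom.comp_apply, aeval_X, Sum.elim_inl, map_zero]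
        exact ⟨LeadingForms.fil_mono _ (hlam i).le (hmem _ _),
          LeadingForms.gr_of_lt _ (hmem _ _) (hlam i)⟩
      | inr j =>
        have h1 := hmem 0 (X j)
        have h2 := hgr 0 (X j)
        rw [map_zero] at h1 h2
        simpa [toLaur] using ⟨h1, h2⟩
  refine ⟨hlam, hr, ?_, ?_⟩
  · rintro (i | j)
    · rw [embed_inl]; exact hmem _ _
    · refine Fin.cases ?_ (fun j => ?_) j
      · rw [embed_Y, weight_Y]
        simpa using LeadingForms.mul_mem _ (hmem (fun i => -(r i : ℤ)) 1) hzero.1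
      · rw [embed_succ, weight_succ]
        simpa using hmem 0 (X j)
  · rintro (i | j)
    · rw [embed_inl, embed_inl]; exact hgr _ _
    · refine Fin.cases ?_ (fun j => ?_) j
      · rw [embed_Y, embed_Y, weight_Y]
        have := LeadingForms.gr_mul _ (hmem (fun i => -(r i : ℤ)) 1) hzero.1
        rw [add_zero] at this
        rw [this, hgr, hzero.2]
      · rw [embed_succ, embed_succ, weight_succ]
        simpa using hgr 0 (X j)

end Embedding

/-! ### Injectivity of the embedding -/

section EmbedA
variable {k : Type} [Field k] {m : ℕ} {r : Fin m → ℕ} (F : MvPolynomial (Fin m ⊕ Fin 2) k)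

variable (r) in
/-- The homomorphism from `A` to the Laurent polynomial ring. -/
def embedA : RingA k m r F →ₐ[k] Laur k m :=
  Ideal.Quotient.liftₐ _ (embed r F) fun a ha => by
    obtain ⟨b, rfl⟩ := Ideal.mem_span_singleton'.1 ha
    rw [map_mul, embed_relG, mul_zero]

theorem embedA_mk (P : BigP k m) : embedA r F (Ideal.Quotient.mk _ P) = embed r F P := rfl

variable {F}

theorem lam_le_of_embed_mem {Γ : Type} [AddCommGroup Γ] [LinearOrder Γ] [IsOrderedAddMonoid Γ]
    {lam : (Fin m → ℤ) →+ Γ} (hr : ∀ i, 1 < r i) (hf : fOf k m F ≠ 0)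
    (hlam : ∀ i, lam (Pi.single i 1) < 0) {c : (Fin m → ℤ) →₀ MvPolynomial (Fin 2) k} {d : Γ}
    (hc : embed r F (normForm k r c) ∈ (LeadingForms.laurent (k := k) lam).fil d) :
    ∀ e ∈ c.support, lam e ≤ d := by
  classical
  intro e he
  obtain ⟨e₀, he₀, hmax⟩ := Finset.exists_max_image c.support lam ⟨e, he⟩
  refine (hmax e he).trans (hc e₀ ?_)
  have h1 := congrArg (fun h => h.coeff e₀)
    ((embed_isLeadingHom F hr hlam).gr_normForm (d := lam e₀) hmax)
  simp only [LeadingForms.coeff_laurent_gr, if_true] at h1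
  rw [h1, coeff_embed_lead_normForm F hr, component,
    Finsupp.filter_apply_pos (fun e => lam e = lam e₀) _ rfl]
  exact mul_ne_zero (Finsupp.mem_support_iff.1 he₀) (pow_ne_zero _ hf)

theorem embedA_injective (hr : ∀ i, 1 < r i) (hf : fOf k m F ≠ 0) :
    Function.Injective (embedA r F) := by
  rw [injective_iff_map_eq_zero]
  intro a ha
  obtain ⟨P, rfl⟩ := Ideal.Quotient.mk_surjective a
  obtain ⟨c, hc⟩ := exists_normForm hr F P
  rw [hc, embedA_mk] at ha
  suffices c = 0 by rw [hc, this, map_zero, map_zero]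
  set lam : (Fin m → ℤ) →+ ℤ := -∑ i, Pi.evalAddMonoidHom (fun _ => ℤ) i with hlam
  have hneg : ∀ i, lam (Pi.single i 1) < 0 := by
    intro i
    simp [hlam, AddMonoidHom.finsetSum_apply, Pi.single_apply]
  by_contra hne
  obtain ⟨e, he⟩ := Finsupp.support_nonempty_iff.2 hne
  have := lam_le_of_embed_mem hr hf hneg (d := lam e - 1) (ha ▸ zero_mem _) e he
  omega

theorem leadF_ne_zero (hf : fOf k m F ≠ 0) : fOf k m (leadF F) ≠ 0 := by rwa [fOf_leadF]

theorem isDomain_ringA (hr : ∀ i, 1 < r i) (hf : fOf k m F ≠ 0) : IsDomain (RingA k m r F) :=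
  (embedA_injective hr hf).isDomain (embedA r F).toRingHom

theorem adjoin_range_mk (I : Ideal (BigP k m)) :
    Algebra.adjoin k (Set.range fun s => Ideal.Quotient.mk I (X s)) = ⊤ := by
  have h : (Set.range fun s => Ideal.Quotient.mk I (X s)) =
      Ideal.Quotient.mkₐ k I '' Set.range X := by
    rw [← Set.range_comp]; rfl
  rw [h, ← AlgHom.map_adjoin, adjoin_range_X, Algebra.map_top,
    AlgHom.range_eq_top]
  exact Ideal.Quotient.mkₐ_surjective k I

end EmbedA

/-! ### Deformation of exponential maps -/

section Deformation
variable {k : Type} [Field k] {m : ℕ} {r : Fin m → ℕ} {F : MvPolynomial (Fin m ⊕ Fin 2) k}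
  {Γ : Type} [AddCommGroup Γ] [LinearOrder Γ] [IsOrderedAddMonoid Γ] {lam : (Fin m → ℤ) →+ Γ}

theorem exists_slope (hr : ∀ i, 1 < r i) (hf : fOf k m F ≠ 0)
    (hlam : ∀ i, lam (Pi.single i 1) < 0) (hdiv : ∀ n : ℕ, n ≠ 0 → ∀ v : Γ, ∃ u, n • u = v)
    (φ : ExpMap k (RingA k m r F)) (hφ : φ.invariants ≠ ⊤) :
    ∃ θ : Γ,
      (∀ s n, embedA r F ((φ.toAlgHom (Ideal.Quotient.mk _ (X s))).coeff n) ∈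
        (LeadingForms.laurent (k := k) lam).fil (weight r lam s + n • θ)) ∧
      ∃ s n, (LeadingForms.laurent (k := k) lam).gr (weight r lam s + (n + 1) • θ)
        (embedA r F ((φ.toAlgHom (Ideal.Quotient.mk _ (X s))).coeff (n + 1))) ≠ 0 := by
  classical
  set p : Fin m ⊕ Fin 3 → Polynomial (RingA k m r F) :=
    fun s => φ.toAlgHom (Ideal.Quotient.mk _ (X s)) with hp
  choose! u hu using hdiv
  set I : Finset (Σ _ : Fin m ⊕ Fin 3, Σ _ : ℕ, (Fin m → ℤ)) :=
    (Finset.univ.sigma fun s => (p s).support.sigma fun n =>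
      (embedA r F ((p s).coeff n)).coeff.support).filter fun x => x.2.1 ≠ 0 with hI
  have hmemI : ∀ s n e, n ≠ 0 → (embedA r F ((p s).coeff n)).coeff e ≠ 0 →
      (⟨s, n, e⟩ : Σ _ : Fin m ⊕ Fin 3, Σ _ : ℕ, (Fin m → ℤ)) ∈ I := by
    intro s n e hn he
    simp only [hI, Finset.mem_filter, Finset.mem_sigma, Finset.mem_univ, true_and,
      Finsupp.mem_support_iff, Polynomial.mem_support_iff]
    refine ⟨⟨fun h => he ?_, he⟩, hn⟩
    rw [h]; simp
  have hne : I.Nonempty := by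
    obtain ⟨_, ⟨s, rfl⟩, hs⟩ := (ExpMap.invariants_ne_top_iff_of_adjoin
      (adjoin_range_mk (Ideal.span {relG k m r F}))).1 hφ
    rw [ExpMap.mem_invariants_iff_coeff] at hs
    push Not at hs
    obtain ⟨n, hn⟩ := hs
    have h1 : embedA r F ((p s).coeff (n + 1)) ≠ 0 := fun h =>
      hn (embedA_injective hr hf (h.trans (map_zero _).symm))
    have h2 : ∃ e, (embedA r F ((p s).coeff (n + 1))).coeff e ≠ 0 := by
      by_contra hcon
      push Not at hcon
      exact h1 (by ext e : 2; exact hcon e)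
    obtain ⟨e, he⟩ := h2
    exact ⟨_, hmemI s (n + 1) e n.succ_ne_zero he⟩
  set v : (Σ _ : Fin m ⊕ Fin 3, Σ _ : ℕ, (Fin m → ℤ)) → Γ :=
    fun x => u x.2.1 (lam x.2.2 - weight r lam x.1) with hv
  obtain ⟨⟨s₀, n₀, e₀⟩, hx₀, hmax⟩ := Finset.exists_max_image I v hne
  have huv : ∀ s n e, n ≠ 0 → lam e = weight r lam s + n • v ⟨s, n, e⟩ := by
    intro s n e hn
    rw [hv, hu n hn]; abel
  refine ⟨v ⟨s₀, n₀, e₀⟩, fun s n => ?_, ?_⟩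
  · rcases Nat.eq_zero_or_pos n with rfl | hn
    · rw [φ.coeff_zero, embedA_mk, zero_smul, add_zero]
      exact (embed_isLeadingHom F hr hlam).mem s
    · intro e he
      rw [huv s n e hn.ne']
      have := hmax _ (hmemI s n e hn.ne' he)
      gcongr
  · simp only [hI, Finset.mem_filter, Finset.mem_sigma, Finset.mem_univ, true_and,
      Finsupp.mem_support_iff] at hx₀
    obtain ⟨n, rfl⟩ := Nat.exists_eq_succ_of_ne_zero hx₀.2
    refine ⟨s₀, n, fun h => hx₀.1.2 ?_⟩
    have h1 := congrArg (fun h => h.coeff e₀) h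
    simp only [LeadingForms.coeff_laurent_gr] at h1
    rw [if_pos (huv s₀ (n + 1) e₀ n.succ_ne_zero)] at h1
    exact h1

/-- The leading form of a non-trivial exponential map on `A`, an exponential map on
`k[X_1,…,X_m,Y,Z,T]/(X^r Y - f(Z,T))`. -/
theorem exists_leading_expMap (hr : ∀ i, 1 < r i) (hf : fOf k m F ≠ 0)
    (hlam : ∀ i, lam (Pi.single i 1) < 0) (hdiv : ∀ n : ℕ, n ≠ 0 → ∀ v : Γ, ∃ u, n • u = v)
    (φ : ExpMap k (RingA k m r F)) (hφ : φ.invariants ≠ ⊤) :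
    ∃ ψ : ExpMap k (RingA k m r (leadF F)), ψ.invariants ≠ ⊤ ∧
      (∀ c d, (∀ e ∈ c.support, lam e ≤ d) →
        Ideal.Quotient.mk _ (normForm k r c) ∈ φ.invariants →
        Ideal.Quotient.mk _ (normForm k r (component lam d c)) ∈ ψ.invariants) ∧
      ∀ c d, Ideal.Quotient.mk _ (normForm k r c) ∈ ψ.invariants →
        Ideal.Quotient.mk _ (normForm k r (component lam d c)) ∈ ψ.invariants := by
  obtain ⟨θ, hθ, s₀, n₀, hne⟩ := exists_slope hr hf hlam hdiv φ hφ
  set lf := LeadingForms.laurent (k := k) (R := MvPolynomial (Fin 2) k) lam with hlf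
  have hE := embed_isLeadingHom F hr hlam
  have hinj := embedA_injective (r := r) hr (leadF_ne_zero hf)
  set α : BigP k m →ₐ[k] Polynomial (Laur k m) :=
    (Polynomial.mapAlgHom (embedA r F)).comp
      (φ.toAlgHom.comp (Ideal.Quotient.mkₐ k (Ideal.span {relG k m r F}))) with hα
  have hαc : ∀ P n, (α P).coeff n =
      embedA r F ((φ.toAlgHom (Ideal.Quotient.mk _ P)).coeff n) := by
    intro P n
    simp [hα]
  set α' : BigP k m →ₐ[k] Polynomial (Laur k m) :=
    aeval fun s => (lf.poly θ).gr (weight r lam s) (α (X s)) with hα'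
  have hL : IsLeadingHom lam (lf.poly θ) r α α' :=
    ⟨hlam, hr, fun s n => by rw [hαc]; exact hθ s n, fun s => by rw [hα', aeval_X]⟩
  have hα'c : ∀ s n, (α' (X s)).coeff n = lf.gr (weight r lam s + n • θ)
      (embedA r F ((φ.toAlgHom (Ideal.Quotient.mk _ (X s))).coeff n)) := by
    intro s n
    rw [← hL.gr, LeadingForms.coeff_poly_gr, hαc]
  have hcomp : ∀ (a : RingA k m r F) d, embedA r F a ∈ lf.fil d →
      ∃ c : (Fin m → ℤ) →₀ MvPolynomial (Fin 2) k, (∀ e ∈ c.support, lam e ≤ d) ∧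
        a = Ideal.Quotient.mk _ (normForm k r c) ∧
        lf.gr d (embedA r F a) =
          embedA r (leadF F) (Ideal.Quotient.mk _ (normForm k r (component lam d c))) := by
    intro a d ha
    obtain ⟨P, rfl⟩ := Ideal.Quotient.mk_surjective a
    obtain ⟨c, hc⟩ := exists_normForm hr F P
    rw [hc, embedA_mk] at ha
    have hle := lam_le_of_embed_mem hr hf hlam ha
    exact ⟨c, hle, hc, by rw [hc, embedA_mk, embedA_mk, hE.gr_normForm hle]⟩
  have hlift : ∀ s, ∃ q : Polynomial (RingA k m r (leadF F)),
      q.map (embedA r (leadF F)).toRingHom = α' (X s) := by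
    intro s
    refine (Polynomial.mem_lifts _).1 ((Polynomial.lifts_iff_coeff_lifts _).2 fun n => ?_)
    obtain ⟨c, _, _, hc⟩ := hcomp _ _ (hθ s n)
    exact ⟨_, hc.symm.trans (hα'c s n).symm⟩
  choose q hq using hlift
  have hmap : ∀ P, Polynomial.mapAlgHom (embedA r (leadF F)) (aeval q P) = α' P := by
    intro P
    have : (Polynomial.mapAlgHom (embedA r (leadF F))).comp (aeval q) = α' := by
      apply MvPolynomial.algHom_ext
      intro s
      rw [AlgHom.comp_apply, aeval_X]
      exact hq s
    exact DFunLike.congr_fun this P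
  have hmapinj : Function.Injective (Polynomial.mapAlgHom (embedA r (leadF F))) :=
    Polynomial.map_injective _ hinj
  have hrel : α (relG k m r F) = 0 := by
    rw [hα, AlgHom.comp_apply, AlgHom.comp_apply, Ideal.Quotient.mkₐ_eq_mk,
      Ideal.Quotient.eq_zero_iff_mem.2 (Ideal.subset_span (Set.mem_singleton _)), map_zero,
      map_zero]
  have hrel' : aeval q (relG k m r (leadF F)) = 0 :=
    hmapinj (by rw [hmap, hL.relG_lead hrel, map_zero])
  set ψ₀ : RingA k m r (leadF F) →ₐ[k] Polynomial (RingA k m r (leadF F)) :=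
    Ideal.Quotient.liftₐ _ (aeval q) fun a ha => by
      obtain ⟨b, rfl⟩ := Ideal.mem_span_singleton'.1 ha
      rw [map_mul, hrel', mul_zero] with hψ₀
  have hψ : ∀ P n, embedA r (leadF F) ((ψ₀ (Ideal.Quotient.mk _ P)).coeff n) = (α' P).coeff n := by
    intro P n
    rw [← hmap, Polynomial.coe_mapAlgHom, Polynomial.coeff_map]
    rfl
  have hstar : ∀ c d n, (∀ e ∈ c.support, lam e ≤ d) →
      embedA r (leadF F)
        ((ψ₀ (Ideal.Quotient.mk _ (normForm k r (component lam d c)))).coeff n) =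
      lf.gr (d + n • θ)
        (embedA r F ((φ.toAlgHom (Ideal.Quotient.mk _ (normForm k r c))).coeff n)) := by
    intro c d n hc
    rw [hψ, ← hL.gr_normForm hc, LeadingForms.coeff_poly_gr, hαc]
  set ψ : ExpMap k (RingA k m r (leadF F)) :=
    ExpMap.ofGenerators ψ₀ _ (adjoin_range_mk _)
      (by
        rintro _ ⟨s, rfl⟩
        apply hinj
        rw [hψ, hα'c, φ.coeff_zero, zero_smul, add_zero, embedA_mk, embedA_mk, hE.gr])
      (by
        rintro _ ⟨s, rfl⟩ i n
        apply hinj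
        obtain ⟨c, hle, hc, hc'⟩ := hcomp _ _ (hθ s n)
        have h1 : (ψ₀ (Ideal.Quotient.mk _ (X s))).coeff n =
            Ideal.Quotient.mk _ (normForm k r (component lam (weight r lam s + n • θ) c)) := by
          apply hinj
          rw [hψ, hα'c, hc']
        dsimp only
        rw [h1, hstar _ _ _ hle, ← hc, φ.iterAt, map_mul (embedA r F), map_mul (embedA r (leadF F)),
          map_natCast (embedA r F), map_natCast (embedA r (leadF F)), hψ, hα'c, ← nsmul_eq_mul',
          ← nsmul_eq_mul', map_nsmul, add_assoc, add_smul])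
  have hψa : ψ.toAlgHom = ψ₀ := rfl
  refine ⟨ψ, ?_, ?_, ?_⟩
  · rw [ExpMap.invariants_ne_top_iff_of_adjoin (adjoin_range_mk _)]
    refine ⟨_, ⟨s₀, rfl⟩, fun h => hne ?_⟩
    rw [ExpMap.mem_invariants_iff_coeff] at h
    rw [← hα'c, ← hψ, ← hψa, h, map_zero]
  · intro c d hc hinv
    rw [ExpMap.mem_invariants_iff_coeff] at hinv ⊢
    intro n
    apply hinj
    rw [hψa, hstar _ _ _ hc, hinv, map_zero, map_zero, map_zero]
  · intro c d hinv
    rw [ExpMap.mem_invariants_iff_coeff] at hinv ⊢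
    intro n
    apply hinj
    rw [hψa, hψ, ← hL.gr_normForm_lead, LeadingForms.coeff_poly_gr, ← hψ, ← hψa, hinv, map_zero,
      map_zero]

end Deformation

/-! ### Invariants of the leading form -/

section Weight
variable {m : ℕ}

/-- A lexicographic weight on Laurent monomials, dominated by the exponent of `X l`. -/
def lexWeight (l : Fin m) : (Fin m → ℤ) →+ ℚ ×ₗ Lex (Fin m → ℚ) :=
  AddMonoidHom.mk' (fun e => toLex (-(e l : ℚ), toLex fun i => -(e i : ℚ))) fun a b => by
    rw [← toLex_add, Prod.mk_add_mk, ← toLex_add]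
    congr 2
    · push_cast [Pi.add_apply]; ring
    · congr 1
      ext i
      push_cast [Pi.add_apply]; ring

theorem lexWeight_apply (l : Fin m) (e : Fin m → ℤ) :
    lexWeight l e = toLex (-(e l : ℚ), toLex fun i => -(e i : ℚ)) := rfl

theorem lexWeight_single_neg (l i : Fin m) : lexWeight l (Pi.single i 1) < 0 := by
  have h : (fun j => -((Pi.single i 1 : Fin m → ℤ) j : ℚ)) < 0 := by
    rw [Pi.lt_def]
    refine ⟨fun j => ?_, i, by simp⟩
    by_cases hj : j = i
    · subst hj; simp
    · simp [hj]
  refine Prod.Lex.toLex_strictMono (Prod.mk_lt_mk.2 (Or.inr ⟨h.le l, Pi.toLex_strictMono h⟩))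

theorem le_of_lexWeight_le {l : Fin m} {e e' : Fin m → ℤ} (h : lexWeight l e ≤ lexWeight l e') :
    e' l ≤ e l := by
  rw [Prod.Lex.le_iff] at h
  simp only [lexWeight_apply, ofLex_toLex] at h
  rcases h with h | h
  · exact_mod_cast (neg_lt_neg_iff.1 h).le
  · exact_mod_cast (neg_inj.1 h.1).ge

theorem lexWeight_injective (l : Fin m) : Function.Injective (lexWeight l) := by
  intro a b h
  have h1 := congrArg (fun x => ofLex (ofLex x).2) h
  ext i
  have := congrFun h1 i
  simpa [lexWeight_apply] using this

theorem exists_nsmul_eq {V : Type} [AddCommGroup V] [Module ℚ V] (n : ℕ) (hn : n ≠ 0) (v : V) :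
    ∃ u, n • u = v :=
  ⟨(n : ℚ)⁻¹ • v, by
    rw [← Nat.cast_smul_eq_nsmul ℚ, smul_smul, mul_inv_cancel₀ (Nat.cast_ne_zero.2 hn), one_smul]⟩

end Weight

section LeadInvariants
variable {k : Type} [Field k] {m : ℕ} {r : Fin m → ℕ} {F : MvPolynomial (Fin m ⊕ Fin 2) k}

theorem mk_normForm_single_ne_zero (hr : ∀ i, 1 < r i) (hf : fOf k m F ≠ 0) (e : Fin m → ℤ)
    {q : MvPolynomial (Fin 2) k} (hq : q ≠ 0) :
    (Ideal.Quotient.mk _ (normForm k r (Finsupp.single e q)) : RingA k m r (leadF F)) ≠ 0 := by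
  intro h
  have h1 := congrArg (fun a => (embedA r (leadF F) a).coeff e) h
  simp only [map_zero] at h1
  rw [embedA_mk, coeff_embed_lead_normForm F hr, Finsupp.single_eq_same] at h1
  exact mul_ne_zero hq (pow_ne_zero _ hf) h1

theorem component_lexWeight (l : Fin m) (c : (Fin m → ℤ) →₀ MvPolynomial (Fin 2) k)
    (e : Fin m → ℤ) :
    component (lexWeight l) (lexWeight l e) c = Finsupp.single e (c e) := by
  classical
  ext1 e'
  rw [component, Finsupp.filter_apply, Finsupp.single_apply]
  by_cases h : e = e'
  · subst h; rw [if_pos rfl, if_pos rfl]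
  · rw [if_neg h, if_neg fun h' => h (lexWeight_injective l h').symm]

theorem mk_normForm_mem_BA (hr : ∀ i, 1 < r i) {c : (Fin m → ℤ) →₀ MvPolynomial (Fin 2) k}
    (hc : ∀ e ∈ c.support, ∀ i, 0 ≤ e i) :
    Ideal.Quotient.mk _ (normForm k r c) ∈ BA k m r F := by
  rw [normForm_eq_sum, map_sum]
  refine sum_mem fun e he => ?_
  rw [normMon, (bexp_eq_zero hr).2 (hc e he), pow_zero, mul_one, map_mul, map_prod]
  have hx (i : Fin m) : xA k m r F i ∈ BA k m r F :=
    Algebra.subset_adjoin (Set.mem_union_left _ (Set.mem_range_self i))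
  have hz : zA k m r F ∈ BA k m r F :=
    Algebra.subset_adjoin (Set.mem_union_right _ (Set.mem_insert _ _))
  have ht : tA k m r F ∈ BA k m r F :=
    Algebra.subset_adjoin (Set.mem_union_right _ (Set.mem_insert_of_mem _ rfl))
  refine mul_mem ?_ (prod_mem fun i _ => ?_)
  · generalize c e = q
    induction q using MvPolynomial.induction_on with
    | C a => rw [← algebraMap_eq, AlgHom.commutes]; exact Subalgebra.algebraMap_mem _ a
    | add p q hp hq => rw [map_add, map_add]; exact add_mem hp hq
    | mul_X p j hp =>
      rw [map_mul, map_mul]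
      refine mul_mem hp ?_
      rw [inclR, rename_X]
      fin_cases j
      · exact hz
      · exact ht
  · rw [map_pow]
    exact pow_mem (hx i) _

theorem exists_invariant_notMem_BA (hlt : BA k m r F < Derksen k (RingA k m r F)) :
    ∃ φ : ExpMap k (RingA k m r F), φ.invariants ≠ ⊤ ∧ ∃ g ∈ φ.invariants, g ∉ BA k m r F := by
  by_contra hcon
  push Not at hcon
  refine hlt.not_ge (Algebra.adjoin_le fun g hg => ?_)
  simp only [Set.mem_iUnion] at hg
  obtain ⟨φ, hφ, hg⟩ := hg
  exact hcon φ hφ g hg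

theorem exists_expMap_y_invariant (hr : ∀ i, 1 < r i) (hf : fOf k m F ≠ 0)
    (hlt : BA k m r F < Derksen k (RingA k m r F)) :
    ∃ ψ : ExpMap k (RingA k m r (leadF F)), ψ.invariants ≠ ⊤ ∧
      yA k m r (leadF F) ∈ ψ.invariants ∧
      ∀ c, Ideal.Quotient.mk _ (normForm k r c) ∈ ψ.invariants → ∀ e,
        Ideal.Quotient.mk _ (normForm k r (Finsupp.single e (c e))) ∈ ψ.invariants := by
  have := isDomain_ringA (r := r) hr (leadF_ne_zero hf)
  obtain ⟨φ, hφ, g, hg, hgB⟩ := exists_invariant_notMem_BA hlt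
  obtain ⟨P, rfl⟩ := Ideal.Quotient.mk_surjective g
  obtain ⟨c, hc⟩ := exists_normForm hr F P
  rw [hc] at hg hgB
  obtain ⟨e, he, l, hl⟩ : ∃ e ∈ c.support, ∃ l, e l < 0 := by
    by_contra hcon
    push Not at hcon
    exact hgB (mk_normForm_mem_BA hr hcon)
  obtain ⟨e₀, he₀, hmax⟩ := Finset.exists_max_image c.support (lexWeight l) ⟨e, he⟩
  obtain ⟨ψ, hψ, h1, h2⟩ := exists_leading_expMap hr hf (lexWeight_single_neg l)
    exists_nsmul_eq φ hφ
  refine ⟨ψ, hψ, ?_, fun c hc e => ?_⟩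
  · have h3 := h1 c (lexWeight l e₀) hmax hg
    rw [component_lexWeight] at h3
    refine ExpMap.mem_invariants_of_dvd h3
      (mk_normForm_single_ne_zero hr hf e₀ (Finsupp.mem_support_iff.1 he₀)) ?_
    rw [normForm_single, normMon, yA]
    have hb : bexp r e₀ ≠ 0 := fun h0 => by
      have := (bexp_eq_zero hr).1 h0 l
      have := le_of_lexWeight_le (hmax e he)
      omega
    exact map_dvd _ ((dvd_pow_self _ hb).trans ((dvd_mul_left _ _).mul_left _))
  · have h3 := h2 c (lexWeight l e) hc
    rwa [component_lexWeight] at h3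

theorem prod_xA_pow_mul_yA :
    (∏ i, xA k m r (leadF F) i ^ r i) * yA k m r (leadF F) =
      Ideal.Quotient.mk _ (inclR k (fOf k m F)) := by
  have h : (Ideal.Quotient.mk (Ideal.span {relG k m r (leadF F)}))
      ((∏ i, X (Sum.inl i) ^ r i) * X (Sum.inr 0)) = Ideal.Quotient.mk _ (inclR k (fOf k m F)) := by
    rw [Ideal.Quotient.eq, ← incl_leadF]
    exact Ideal.subset_span rfl
  rw [← h, map_mul, map_prod]
  simp only [map_pow]
  rfl

/-- If no variable `x i` is invariant, then the exponents of invariants are multiples of `r`. -/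
theorem invariant_exponents (hr : ∀ i, 1 < r i) (hf : fOf k m F ≠ 0)
    {ψ : ExpMap k (RingA k m r (leadF F))}
    (hψ : ∀ c, Ideal.Quotient.mk _ (normForm k r c) ∈ ψ.invariants → ∀ e,
      Ideal.Quotient.mk _ (normForm k r (Finsupp.single e (c e))) ∈ ψ.invariants)
    (hx : ∀ i, xA k m r (leadF F) i ∉ ψ.invariants)
    {c : (Fin m → ℤ) →₀ MvPolynomial (Fin 2) k}
    (hc : Ideal.Quotient.mk _ (normForm k r c) ∈ ψ.invariants) (e : Fin m → ℤ) (he : c e ≠ 0)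
    (i : Fin m) : e i = -(bexp r e * r i : ℤ) := by
  have := isDomain_ringA (r := r) hr (leadF_ne_zero hf)
  have h1 : aexp r e i = 0 := by
    by_contra ha
    refine hx i (ExpMap.mem_invariants_of_dvd (hψ c hc e)
      (mk_normForm_single_ne_zero hr hf e he) ?_)
    rw [normForm_single, normMon, xA]
    refine map_dvd _ (Dvd.dvd.mul_left (Dvd.dvd.mul_right ?_ _) _)
    exact (dvd_pow_self _ ha).trans
      (Finset.dvd_prod_of_mem (fun i => X (Sum.inl i) ^ aexp r e i) (Finset.mem_univ i))
  have h2 := aexp_cast hr e i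
  rw [h1] at h2
  push_cast at h2
  linarith

/-- Some variable `x l` is invariant. -/
theorem exists_x_invariant (hm : 1 < m) (hr : ∀ i, 1 < r i) (hf : fOf k m F ≠ 0)
    (ψ : ExpMap k (RingA k m r (leadF F)))
    (hψ : ∀ c, Ideal.Quotient.mk _ (normForm k r c) ∈ ψ.invariants → ∀ e,
      Ideal.Quotient.mk _ (normForm k r (Finsupp.single e (c e))) ∈ ψ.invariants) :
    ∃ l, xA k m r (leadF F) l ∈ ψ.invariants := by
  classical
  by_contra hcon
  push Not at hcon
  have := isDomain_ringA (r := r) hr (leadF_ne_zero hf)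
  set i₀ : Fin m := ⟨0, by omega⟩ with hi₀
  set i₁ : Fin m := ⟨1, hm⟩ with hi₁
  have hi : i₀ ≠ i₁ := by simp [hi₀, hi₁, Fin.ext_iff]
  set ζ : RingA k m r (leadF F) := Ideal.Quotient.mk _ (inclR k (fOf k m F)) with hζ
  set x := xA k m r (leadF F) i₀ with hx
  have hinj := embedA_injective (r := r) hr (leadF_ne_zero hf)
  have hζe : embedA r (leadF F) ζ = AddMonoidAlgebra.single 0 (fOf k m F) := by
    rw [hζ, embedA_mk, embed_inclR]
  have hζ0 : ζ ≠ 0 := fun h => by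
    rw [h, map_zero] at hζe
    exact hf (by simpa using congrArg (fun h => h.coeff 0) hζe.symm)
  suffices hζinv : ζ ∈ ψ.invariants by
    refine hcon i₀ (ExpMap.mem_invariants_of_dvd hζinv hζ0 ?_)
    rw [hζ, ← prod_xA_pow_mul_yA]
    refine Dvd.dvd.mul_right ((dvd_pow_self _ (by have := hr i₀; omega)).trans
      (Finset.dvd_prod_of_mem (fun i => xA k m r (leadF F) i ^ r i) (Finset.mem_univ i₀))) _
  set μ : (Fin m → ℤ) →+ ℤ := AddMonoidHom.mk' (fun e => e i₀ * r i₁ - e i₁ * r i₀) (fun a b => by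
    simp only [Pi.add_apply]; ring) with hμ
  have hμa : ∀ e, μ e = e i₀ * r i₁ - e i₁ * r i₀ := fun e => rfl
  set lf := LeadingForms.laurent (k := k) (R := MvPolynomial (Fin 2) k) μ with hlf
  have hinvgr : ∀ a ∈ ψ.invariants, lf.gr 0 (embedA r (leadF F) a) = embedA r (leadF F) a := by
    intro a ha
    obtain ⟨P, rfl⟩ := Ideal.Quotient.mk_surjective a
    obtain ⟨c, hc⟩ := exists_normForm hr (leadF F) P
    rw [hc] at ha ⊢
    ext e : 2
    rw [LeadingForms.coeff_laurent_gr, embedA_mk, coeff_embed_lead_normForm F hr]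
    split_ifs with h
    · rfl
    · by_cases he : c e = 0
      · rw [he, zero_mul]
      · have h1 := invariant_exponents hr hf hψ hcon ha e he
        refine absurd ?_ h
        rw [hμa, h1 i₀, h1 i₁]; ring
  set d := (ψ.toAlgHom ζ).natDegree + (ψ.toAlgHom x).natDegree with hd
  obtain ⟨c, hc, ⟨⟨i', j'⟩, hij, hne⟩, hsum⟩ := ψ.exists_dependence (d * (d + 1) + 1)
    (Finset.range (d + 2) ×ˢ Finset.range (d + 2)) (fun p : ℕ × ℕ => ζ ^ p.1 * x ^ p.2)
    (by rw [Finset.card_product, Finset.card_range]; nlinarith) (by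
      rintro ⟨i, j⟩ hp
      simp only [Finset.mem_product, Finset.mem_range] at hp
      rw [map_mul, map_pow, map_pow]
      refine (Polynomial.degree_le_natDegree).trans_lt ?_
      rw [Nat.cast_lt]
      have h1 : i * (ψ.toAlgHom ζ).natDegree ≤ (d + 1) * (ψ.toAlgHom ζ).natDegree :=
        Nat.mul_le_mul_right _ (by omega)
      have h2 : j * (ψ.toAlgHom x).natDegree ≤ (d + 1) * (ψ.toAlgHom x).natDegree :=
        Nat.mul_le_mul_right _ (by omega)
      calc _ ≤ (ψ.toAlgHom ζ ^ i).natDegree + (ψ.toAlgHom x ^ j).natDegree :=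
            Polynomial.natDegree_mul_le
        _ ≤ i * (ψ.toAlgHom ζ).natDegree + j * (ψ.toAlgHom x).natDegree :=
            add_le_add Polynomial.natDegree_pow_le Polynomial.natDegree_pow_le
        _ ≤ (d + 1) * (ψ.toAlgHom ζ).natDegree + (d + 1) * (ψ.toAlgHom x).natDegree :=
            add_le_add h1 h2
        _ = d * (d + 1) := by rw [← mul_add, ← hd, mul_comm]
        _ < d * (d + 1) + 1 := Nat.lt_succ_self _)
  rw [Finset.mem_product] at hij
  refine ψ.mem_invariants_of_algebraic (Finset.range (d + 2)) (fun i => c (i, j'))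
    (fun i => hc _) ⟨i', hij.1, hne⟩ (hinj ?_)
  rw [map_zero]
  set g : ℕ → RingA k m r (leadF F) := fun j => ∑ i ∈ Finset.range (d + 2), c (i, j) * ζ ^ i
    with hg
  have hsum' : ∑ j ∈ Finset.range (d + 2), g j * x ^ j = 0 := by
    rw [← hsum, Finset.sum_product_right]
    refine Finset.sum_congr rfl fun j _ => ?_
    rw [hg, Finset.sum_mul]
    exact Finset.sum_congr rfl fun i _ => by ring
  have hmem : ∀ {D : ℤ} {a}, lf.gr D a = a → a ∈ lf.fil D := fun h => h ▸ lf.gr_mem _ _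
  have hpow : ∀ i, lf.gr 0 (embedA r (leadF F) ζ ^ i) = embedA r (leadF F) ζ ^ i := by
    intro i
    rw [hζe, AddMonoidAlgebra.single_pow, LeadingForms.laurent_gr_single, smul_zero, map_zero,
      if_pos rfl]
  have hggr : ∀ j, lf.gr 0 (embedA r (leadF F) (g j)) = embedA r (leadF F) (g j) := by
    intro j
    simp only [hg, map_sum, map_mul, map_pow]
    refine Finset.sum_congr rfl fun i _ => ?_
    have h1 := hinvgr _ (hc (i, j))
    have h2 := lf.gr_mul (hmem h1) (hmem (hpow i))
    rwa [h1, hpow, add_zero] at h2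
  have hxe : ∀ j : ℕ, embedA r (leadF F) x ^ j =
      AddMonoidAlgebra.single (j • Pi.single i₀ 1) 1 := by
    intro j
    rw [hx, xA, embedA_mk, embed_inl, AddMonoidAlgebra.single_pow, one_pow]
  have hxgr : ∀ j : ℕ, lf.gr (j * r i₁ : ℤ) (embedA r (leadF F) x ^ j) =
      embedA r (leadF F) x ^ j := by
    intro j
    rw [hxe, LeadingForms.laurent_gr_single, if_pos]
    simp [hμa, hi.symm]
  have hterm : ∀ j : ℕ, lf.gr (j * r i₁ : ℤ)
      (embedA r (leadF F) (g j) * embedA r (leadF F) x ^ j) =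
        embedA r (leadF F) (g j) * embedA r (leadF F) x ^ j := by
    intro j
    have h := lf.gr_mul (hmem (hggr j)) (hmem (hxgr j))
    rwa [hggr, hxgr, zero_add] at h
  have h1 := congrArg (fun a => lf.gr (j' * r i₁ : ℤ) (embedA r (leadF F) a)) hsum'
  simp only [map_sum, map_zero, map_mul, map_pow] at h1
  rw [Finset.sum_eq_single_of_mem j' hij.2, hterm] at h1
  · refine (mul_eq_zero.1 h1).resolve_right (pow_ne_zero _ fun h => ?_)
    have := hxe 1
    rw [pow_one, h] at this
    have := congrArg (fun h => h.coeff (1 • Pi.single i₀ 1)) this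
    simp at this
  · intro j _ hj
    rw [← hterm, lf.gr_gr_ne]
    have := hr i₁
    have h0 : (r i₁ : ℤ) ≠ 0 := by omega
    exact fun h => hj (by exact_mod_cast (mul_right_cancel₀ h0 h).symm)

end LeadInvariants

/-! ### Extension of exponential maps to `A_l` -/

namespace ExpMap

section Extend
variable {k L A D : Type} [CommRing k] [CommRing L] [CommRing A] [CommRing D] [Algebra k A]
  [Algebra L D]

/-- Extension of an exponential map along a homomorphism whose image generates the target. -/
def extend (ψ : ExpMap k A) (j : A →+* D) (hs : Algebra.adjoin L (Set.range j) = ⊤)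
    (φ : D →ₐ[L] Polynomial D) (hφ : ∀ a, φ (j a) = (ψ.toAlgHom a).map j) : ExpMap L D :=
  ofGenerators φ (Set.range j) hs
    (by
      rintro _ ⟨a, rfl⟩
      rw [hφ, Polynomial.coeff_map, ψ.coeff_zero])
    (by
      rintro _ ⟨a, rfl⟩ i n
      rw [hφ, Polynomial.coeff_map, Polynomial.coeff_map, hφ, Polynomial.coeff_map, ψ.iterAt a i n,
        map_mul, map_natCast])

variable {ψ : ExpMap k A} {j : A →+* D} {hs : Algebra.adjoin L (Set.range j) = ⊤}
  {φ : D →ₐ[L] Polynomial D} {hφ : ∀ a, φ (j a) = (ψ.toAlgHom a).map j}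

theorem map_mem_invariants_extend {a : A} (ha : a ∈ ψ.invariants) :
    j a ∈ (ψ.extend j hs φ hφ).invariants := by
  rw [mem_invariants] at ha ⊢
  exact (hφ a).trans (by rw [ha, Polynomial.map_C])

theorem extend_invariants_ne_top (hj : Function.Injective j) (hψ : ψ.invariants ≠ ⊤) :
    (ψ.extend j hs φ hφ).invariants ≠ ⊤ := by
  intro h
  refine hψ (eq_top_iff.2 fun a _ => ?_)
  have ha : j a ∈ (ψ.extend j hs φ hφ).invariants := h ▸ Algebra.mem_top
  rw [mem_invariants] at ha ⊢
  refine Polynomial.map_injective j hj ?_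
  rw [Polynomial.map_C, ← ha]
  exact (hφ a).symm

end Extend

end ExpMap

section BaseChange
variable {k : Type} [Field k] {m : ℕ} {r : Fin m → ℕ} {F : MvPolynomial (Fin m ⊕ Fin 2) k}
  {l : Fin m}

variable (l) in
/-- The images of the variables `X_1,…,X_m,Y,Z,T` in `k(X_l)[X_i (i ≠ l), Y, Z, T]`. -/
def varAL : Fin m ⊕ Fin 3 → MvPolynomial (VarL m l) (RatFunc k) :=
  Sum.elim (fun i => if h : i = l then C RatFunc.X else X (Sum.inl ⟨i, h⟩)) fun j => X (Sum.inr j)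

theorem varAL_self : varAL (k := k) l (Sum.inl l) = C RatFunc.X := by simp [varAL]

theorem varAL_ne {i : Fin m} (h : i ≠ l) :
    varAL (k := k) l (Sum.inl i) = X (Sum.inl ⟨i, h⟩) := by simp [varAL, h]

theorem varAL_inr (j : Fin 3) : varAL (k := k) l (Sum.inr j) = X (Sum.inr j) := rfl

theorem aeval_varAL_relG : aeval (varAL l) (relG k m r (leadF F)) = relL k m r F l := by
  rw [relG, incl_leadF, map_sub, map_mul, map_prod, relL]
  congr 1
  · simp only [map_pow, aeval_X]
    rw [Fintype.prod_eq_mul_prod_subtype_ne _ l, varAL_self, varAL_inr]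
    congr 2
    exact Finset.prod_congr rfl fun i _ => by rw [varAL_ne i.2]
  · rw [inclR, aeval_rename]
    rfl

variable (r F l) in
/-- The homomorphism `k[X_1,…,X_m,Y,Z,T]/(X^r Y - f) → A_l`. -/
def toAL : RingA k m r (leadF F) →ₐ[k] RingAL k m r F l :=
  Ideal.Quotient.liftₐ _ ((Ideal.Quotient.mkₐ k _).comp (aeval (varAL l))) fun a ha => by
    obtain ⟨b, rfl⟩ := Ideal.mem_span_singleton'.1 ha
    rw [AlgHom.comp_apply, map_mul, aeval_varAL_relG]
    exact Ideal.Quotient.eq_zero_iff_mem.2 (Ideal.mul_mem_left _ _ (Ideal.subset_span rfl))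

theorem toAL_mk (P : BigP k m) : toAL r F l (Ideal.Quotient.mk _ P) =
    Ideal.Quotient.mk _ (aeval (varAL l) P) := rfl

theorem toAL_xA : toAL r F l (xA k m r (leadF F) l) =
    algebraMap (RatFunc k) (RingAL k m r F l) RatFunc.X := by
  rw [xA, toAL_mk, aeval_X, varAL_self]
  rfl

theorem toAL_var (s : VarL m l) : toAL r F l (Ideal.Quotient.mk _ (X (Sum.map (·.1) id s))) =
    Ideal.Quotient.mk _ (X s) := by
  rw [toAL_mk, aeval_X]
  rcases s with i | j
  · rw [Sum.map_inl, varAL_ne i.2]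
  · rfl

theorem adjoin_range_toAL_var : Algebra.adjoin (RatFunc k)
    (Set.range fun s : VarL m l => (Ideal.Quotient.mk _ (X s) : RingAL k m r F l)) = ⊤ := by
  have h : (Set.range fun s : VarL m l => (Ideal.Quotient.mk _ (X s) : RingAL k m r F l)) =
      Ideal.Quotient.mkₐ (RatFunc k) _ '' Set.range X := by
    rw [← Set.range_comp]; rfl
  rw [h, ← AlgHom.map_adjoin, adjoin_range_X, Algebra.map_top, AlgHom.range_eq_top]
  exact Ideal.Quotient.mkₐ_surjective _ _

theorem adjoin_range_toAL : Algebra.adjoin (RatFunc k) (Set.range (toAL r F l).toRingHom) = ⊤ := by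
  rw [eq_top_iff, ← adjoin_range_toAL_var]
  refine Algebra.adjoin_mono ?_
  rintro _ ⟨s, rfl⟩
  exact ⟨_, toAL_var s⟩

theorem coeff_aeval_single (p : Polynomial k) (n : ℕ) :
    (Polynomial.aeval (AddMonoidAlgebra.single (Pi.single l 1) 1 : Laur k m) p).coeff
      (Pi.single l (n : ℤ)) = C (p.coeff n) := by
  classical
  induction p using Polynomial.induction_on' with
  | add p q hp hq => rw [map_add, AddMonoidAlgebra.coeff_add, Finsupp.add_apply, hp, hq,
      Polynomial.coeff_add, map_add]
  | monomial j a =>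
    rw [Polynomial.aeval_monomial, AddMonoidAlgebra.single_pow, one_pow, ← Algebra.smul_def,
      AddMonoidAlgebra.smul_single, AddMonoidAlgebra.coeff_single, Finsupp.single_apply,
      Polynomial.coeff_monomial]
    have h : j • (Pi.single l 1 : Fin m → ℤ) = Pi.single l (j : ℤ) := by
      rw [← Pi.single_smul]; simp
    rw [h]
    by_cases hj : j = n
    · subst hj
      rw [if_pos rfl, if_pos rfl, smul_eq_C_mul, mul_one]
    · rw [if_neg hj, if_neg, map_zero]
      exact fun h' => hj (by exact_mod_cast Pi.single_injective (M := fun _ => ℤ) l h')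

theorem toAL_injective (hr : ∀ i, 1 < r i) (hf : fOf k m F ≠ 0) :
    Function.Injective (toAL r F l) := by
  set K := FractionRing (Laur k m)
  set ι : Laur k m →ₐ[k] K := IsScalarTower.toAlgHom k (Laur k m) K with hι
  have hιinj : Function.Injective ι := IsFractionRing.injective (Laur k m) K
  set θ : Polynomial k →ₐ[k] K :=
    ι.comp (Polynomial.aeval (AddMonoidAlgebra.single (Pi.single l 1) 1)) with hθ
  have hθinj : Function.Injective θ := by
    refine hιinj.comp ((injective_iff_map_eq_zero _).2 fun p hp => ?_)
    ext n
    have := coeff_aeval_single (m := m) (l := l) p n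
    rw [hp] at this
    exact (C_injective _ _ (by simpa using this)).symm
  set Θ : RatFunc k →ₐ[k] K :=
    RatFunc.liftAlgHom θ (nonZeroDivisors_le_comap_nonZeroDivisors_of_injective _ hθinj) with hΘ
  have hΘX : Θ RatFunc.X = ι (AddMonoidAlgebra.single (Pi.single l 1) 1) := by
    have h := RatFunc.liftAlgHom_apply_div θ
      (nonZeroDivisors_le_comap_nonZeroDivisors_of_injective _ hθinj) Polynomial.X 1
    rw [map_one, map_one, div_one, div_one, RatFunc.algebraMap_X] at h
    rw [hΘ, h, hθ, AlgHom.comp_apply, Polynomial.aeval_X]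
  set β : MvPolynomial (VarL m l) (RatFunc k) →+* K := eval₂Hom Θ.toRingHom
    fun s => ι (embed r (leadF F) (X (Sum.map (·.1) id s))) with hβ
  have hcomp : ∀ P, β (aeval (varAL l) P) = ι (embed r (leadF F) P) := by
    intro P
    suffices β.comp
        (aeval (varAL l) : BigP k m →ₐ[k] MvPolynomial (VarL m l) (RatFunc k)).toRingHom =
        (ι.comp (embed r (leadF F))).toRingHom from DFunLike.congr_fun this P
    refine MvPolynomial.ringHom_ext (fun a => ?_) fun s => ?_
    · have h1 : aeval (varAL (k := k) l) (C a : BigP k m) =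
          C (algebraMap k (RatFunc k) a) := by
        rw [← algebraMap_eq, AlgHom.commutes]; rfl
      have h2 : ι (embed r (leadF F) (C a)) = algebraMap k K a := by
        rw [← algebraMap_eq, AlgHom.commutes, AlgHom.commutes]
      refine (congrArg β h1).trans (Eq.trans ?_ h2.symm)
      rw [hβ, eval₂Hom_C]
      exact Θ.commutes a
    · have h1 : aeval (varAL l) (X s : BigP k m) = varAL (k := k) l s := aeval_X _ _
      refine (congrArg β h1).trans ?_
      change _ = ι (embed r (leadF F) (X s))
      rcases s with i | j
      · by_cases h : i = l
        · subst h
          rw [varAL_self, hβ, eval₂Hom_C, embed_inl, ← hΘX]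
          rfl
        · rw [varAL_ne h, hβ, eval₂Hom_X']
          rfl
      · rw [varAL_inr, hβ, eval₂Hom_X']
        rfl
  have hrel : ∀ a ∈ Ideal.span {relL k m r F l}, β a = 0 := by
    intro a ha
    obtain ⟨b, rfl⟩ := Ideal.mem_span_singleton'.1 ha
    rw [map_mul, ← aeval_varAL_relG, hcomp, embed_relG, map_zero, mul_zero]
  refine (injective_iff_map_eq_zero _).2 fun a ha => ?_
  obtain ⟨P, rfl⟩ := Ideal.Quotient.mk_surjective a
  refine embedA_injective hr (leadF_ne_zero hf) (hιinj ?_)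
  rw [embedA_mk, ← hcomp, map_zero, map_zero]
  exact hrel _ (Ideal.Quotient.eq_zero_iff_mem.1 ha)

/-- An exponential map fixing `x l` extends to `A_l`. -/
theorem exists_extend (hr : ∀ i, 1 < r i) (hf : fOf k m F ≠ 0)
    (ψ : ExpMap k (RingA k m r (leadF F))) (hψ : ψ.invariants ≠ ⊤)
    (hx : xA k m r (leadF F) l ∈ ψ.invariants) :
    ∃ Ψ : ExpMap (RatFunc k) (RingAL k m r F l), Ψ.invariants ≠ ⊤ ∧
      ∀ a ∈ ψ.invariants, toAL r F l a ∈ Ψ.invariants := by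
  set γ : RingA k m r (leadF F) →+* Polynomial (RingAL k m r F l) :=
    (Polynomial.mapRingHom (toAL r F l).toRingHom).comp ψ.toAlgHom.toRingHom with hγ
  have hγa : ∀ a, γ a = (ψ.toAlgHom a).map (toAL r F l).toRingHom := fun a => rfl
  set β : MvPolynomial (VarL m l) (RatFunc k) →ₐ[RatFunc k] Polynomial (RingAL k m r F l) :=
    aeval fun s => γ (Ideal.Quotient.mk _ (X (Sum.map (·.1) id s))) with hβ
  have hcomp : ∀ P, β (aeval (varAL l) P) = γ (Ideal.Quotient.mk _ P) := by
    intro P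
    suffices β.toRingHom.comp
        (aeval (varAL l) : BigP k m →ₐ[k] MvPolynomial (VarL m l) (RatFunc k)).toRingHom =
        γ.comp (Ideal.Quotient.mk _) from DFunLike.congr_fun this P
    refine MvPolynomial.ringHom_ext (fun a => ?_) fun s => ?_
    · have h1 : aeval (varAL (k := k) l) (C a : BigP k m) =
          algebraMap (RatFunc k) _ (algebraMap k (RatFunc k) a) := by
        rw [← algebraMap_eq, AlgHom.commutes]; rfl
      refine (congrArg β h1).trans ?_
      rw [AlgHom.commutes]
      change _ = γ (algebraMap k _ a)
      rw [hγa, AlgHom.commutes, Polynomial.algebraMap_apply, Polynomial.algebraMap_apply,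
        Polynomial.map_C]
      congr 1
      exact ((toAL r F l).commutes a).symm
    · have h1 : aeval (varAL l) (X s : BigP k m) = varAL (k := k) l s := aeval_X _ _
      refine (congrArg β h1).trans ?_
      change _ = γ (Ideal.Quotient.mk _ (X s))
      rcases s with i | j
      · by_cases h : i = l
        · subst h
          rw [varAL_self, ← algebraMap_eq, AlgHom.commutes]
          change _ = γ (xA k m r (leadF F) i)
          rw [hγa, ExpMap.mem_invariants.1 hx, Polynomial.map_C, Polynomial.algebraMap_apply]
          exact congrArg Polynomial.C toAL_xA.symm
        · rw [varAL_ne h, hβ, aeval_X]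
          rfl
      · rw [varAL_inr, hβ, aeval_X]
        rfl
  have hrel : ∀ a ∈ Ideal.span {relL k m r F l}, β a = 0 := by
    intro a ha
    obtain ⟨b, rfl⟩ := Ideal.mem_span_singleton'.1 ha
    have h : β (relL k m r F l) = 0 := by
      have h := hcomp (relG k m r (leadF F))
      rwa [Ideal.Quotient.eq_zero_iff_mem.2 (Ideal.subset_span (Set.mem_singleton _)), map_zero,
        aeval_varAL_relG] at h
    rw [map_mul, h, mul_zero]
  have hφ : ∀ a, Ideal.Quotient.liftₐ _ β hrel ((toAL r F l).toRingHom a) =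
      (ψ.toAlgHom a).map (toAL r F l).toRingHom := by
    intro a
    obtain ⟨P, rfl⟩ := Ideal.Quotient.mk_surjective a
    exact hcomp P
  exact ⟨ψ.extend (toAL r F l).toRingHom adjoin_range_toAL _ hφ,
    ExpMap.extend_invariants_ne_top (toAL_injective hr hf) hψ,
    fun a ha => ExpMap.map_mem_invariants_extend ha⟩

end BaseChange

/-! ### Elementary exponential maps -/

section Elementary
variable {k : Type} [Field k] {m : ℕ} {r : Fin m → ℕ} {F : MvPolynomial (Fin m ⊕ Fin 2) k}

theorem dvd_aeval_sub_aeval {S σ : Type} [CommRing S] [Algebra k S] (δ : S) (w v : σ → S)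
    (h : ∀ i, δ ∣ w i - v i) (q : MvPolynomial σ k) : δ ∣ aeval w q - aeval v q := by
  induction q using MvPolynomial.induction_on with
  | C a => simp
  | add p q hp hq =>
    rw [map_add, map_add, add_sub_add_comm]
    exact dvd_add hp hq
  | mul_X p i hp =>
    have : aeval w (p * X i) - aeval v (p * X i) =
        (aeval w p - aeval v p) * w i + aeval v p * (w i - v i) := by
      rw [map_mul, map_mul, aeval_X, aeval_X]; ring
    rw [this]
    exact dvd_add (hp.mul_right _) ((h i).mul_left _)

theorem aeval_C_comp {S σ : Type} [CommRing S] [Algebra k S] (v : σ → S) (q : MvPolynomial σ k) :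
    aeval (fun i => Polynomial.C (v i)) q = Polynomial.C (aeval v q) :=
  (comp_aeval_apply (φ := (Polynomial.CAlgHom : S →ₐ[k] Polynomial S)) v q).symm

theorem ExpMap.iterAt_of_eq_C_add {D : Type} [CommRing D] [Algebra k D]
    (φ : D →ₐ[k] Polynomial D) {d ρ : D} (hρ : φ ρ = Polynomial.C ρ)
    (hd : φ d = Polynomial.C d + Polynomial.C ρ * Polynomial.X) : ExpMap.IterAt φ d := by
  have h1 : ∀ a, φ.toRingHom a = φ a := fun _ => rfl
  rw [ExpMap.iterAt_iff]
  simp only [ExpMap.iterHom, ExpMap.shiftHom, RingHom.comp_apply, h1, hd]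
  simp [hd, hρ]
  ring

theorem prod_xA_pow_mul_yA_ne_zero (hf : fOf k m F ≠ 0) :
    (∏ i, xA k m r (leadF F) i ^ r i) * yA k m r (leadF F) ≠ 0 := by
  rw [prod_xA_pow_mul_yA]
  intro h
  have h1 := congrArg (embedA r (leadF F)) h
  rw [embedA_mk, embed_inclR, map_zero] at h1
  exact hf (by simpa using congrArg (fun h => h.coeff 0) h1)

theorem mk_inclR_eq_aeval (q : MvPolynomial (Fin 2) k) :
    (Ideal.Quotient.mk _ (inclR k q) : RingA k m r F) =
      aeval (fun j : Fin 2 => (Ideal.Quotient.mk _ (X (Sum.inr j.succ)) : RingA k m r F)) q := by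
  have h : (Ideal.Quotient.mkₐ k (Ideal.span {relG k m r F})).comp (inclR k) =
      aeval (fun j : Fin 2 => (Ideal.Quotient.mk _ (X (Sum.inr j.succ)) : RingA k m r F)) := by
    refine MvPolynomial.algHom_ext fun j => ?_
    rw [AlgHom.comp_apply, inclR, rename_X, aeval_X]
    rfl
  exact DFunLike.congr_fun h q

theorem relG_leadF : relG k m r (leadF F) =
    (∏ i, X (Sum.inl i) ^ r i) * X (Sum.inr 0) - inclR k (fOf k m F) := by
  rw [relG, incl_leadF]

/-- The exponential map moving only `y` and one of `z` and `t`. -/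
theorem exists_elementary (hr : ∀ i, 1 < r i) (hf : fOf k m F ≠ 0) (j : Fin 2) :
    ∃ ψ : ExpMap k (RingA k m r (leadF F)), ψ.invariants ≠ ⊤ ∧
      (∀ i, xA k m r (leadF F) i ∈ ψ.invariants) ∧
      ∀ i, i ≠ j → Ideal.Quotient.mk _ (X (Sum.inr i.succ)) ∈ ψ.invariants := by
  classical
  have := isDomain_ringA (r := r) hr (leadF_ne_zero hf)
  set ρ : RingA k m r (leadF F) := ∏ i, xA k m r (leadF F) i ^ r i with hρ
  set y := yA k m r (leadF F) with hy
  set v : Fin 2 → RingA k m r (leadF F) := fun i => Ideal.Quotient.mk _ (X (Sum.inr i.succ))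
    with hv
  have hρy : ρ * y = aeval v (fOf k m F) := by
    rw [hρ, hy, prod_xA_pow_mul_yA, mk_inclR_eq_aeval]
  have hρ0 : ρ ≠ 0 := left_ne_zero_of_mul (prod_xA_pow_mul_yA_ne_zero hf)
  set w : Fin 2 → Polynomial (RingA k m r (leadF F)) :=
    fun i => Polynomial.C (v i) + Polynomial.C (if i = j then ρ else 0) * Polynomial.X with hw
  obtain ⟨g, hg⟩ := dvd_aeval_sub_aeval (Polynomial.C ρ * Polynomial.X) w
    (fun i => Polynomial.C (v i)) (fun i => by
      rw [hw, add_sub_cancel_left]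
      split_ifs
      · exact dvd_rfl
      · simp) (fOf k m F)
  have hCv : aeval (fun i => Polynomial.C (v i)) (fOf k m F) = Polynomial.C (ρ * y) := by
    rw [hρy, aeval_C_comp]
  set α : BigP k m →ₐ[k] Polynomial (RingA k m r (leadF F)) :=
    aeval (Sum.elim (fun i => Polynomial.C (xA k m r (leadF F) i))
      (Fin.cons (Polynomial.C y + Polynomial.X * g) w)) with hα
  have hαx : ∀ i, α (X (Sum.inl i)) = Polynomial.C (xA k m r (leadF F) i) := fun i => by
    rw [hα, aeval_X]; rfl
  have hαy : α (X (Sum.inr 0)) = Polynomial.C y + Polynomial.X * g := by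
    rw [hα, aeval_X]; rfl
  have hαv : ∀ i : Fin 2, α (X (Sum.inr i.succ)) = w i := fun i => by
    rw [hα, aeval_X]; rfl
  have hαρ : α (∏ i, X (Sum.inl i) ^ r i) = Polynomial.C ρ := by
    simp only [map_prod, map_pow, hαx, hρ]
  have hαf : α (inclR k (fOf k m F)) = aeval w (fOf k m F) := by
    rw [inclR, hα, aeval_rename]
    rfl
  have hrel : ∀ a ∈ Ideal.span {relG k m r (leadF F)}, α a = 0 := by
    intro a ha
    obtain ⟨b, rfl⟩ := Ideal.mem_span_singleton'.1 ha
    have : α (relG k m r (leadF F)) = 0 := by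
      refine (congrArg α relG_leadF).trans ?_
      rw [map_sub, map_mul, hαρ, hαy, hαf, sub_eq_iff_eq_add.1 hg, hCv, map_mul]
      ring
    rw [map_mul, this, mul_zero]
  set φ : RingA k m r (leadF F) →ₐ[k] Polynomial (RingA k m r (leadF F)) :=
    Ideal.Quotient.liftₐ _ α hrel with hφ
  have hφx : ∀ i, φ (xA k m r (leadF F) i) = Polynomial.C (xA k m r (leadF F) i) := hαx
  have hφy : φ y = Polynomial.C y + Polynomial.X * g := hαy
  have hφv : ∀ i, φ (v i) = w i := hαv
  have hφρ : φ ρ = Polynomial.C ρ := by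
    simp only [hρ, map_prod, map_pow, hφx]
  have iter_of_C : ∀ d, φ d = Polynomial.C d → ExpMap.IterAt φ d := fun d hd =>
    ExpMap.iterAt_of_eq_C_add φ (ρ := 0) (by simp) (by simp [hd])
  have iter_v : ∀ i, ExpMap.IterAt φ (v i) := fun i =>
    ExpMap.iterAt_of_eq_C_add φ (by split_ifs; exacts [hφρ, by simp]) (hφv i)
  have iter_y : ExpMap.IterAt φ y := by
    have h1 : ExpMap.IterAt φ (ρ * y) := by
      refine ExpMap.iterAt_of_mem_adjoin φ (s := Set.range v) (by rintro _ ⟨i, rfl⟩; exact iter_v i)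
        ?_
      rw [hρy, Algebra.adjoin_range_eq_range_aeval]
      exact ⟨_, rfl⟩
    have h2 := iter_of_C ρ hφρ
    rw [ExpMap.iterAt_iff] at h1 h2 ⊢
    rw [map_mul, map_mul, ← h2] at h1
    refine mul_left_cancel₀ (fun h0 => hρ0 ?_) h1
    have h3 := ExpMap.coeff_coeff_iterHom φ ρ 0 0
    rw [h0, hφρ, Polynomial.coeff_C_zero, hφρ, Polynomial.coeff_C_zero] at h3
    simpa using h3.symm
  set ψ := ExpMap.ofGenerators φ _ (adjoin_range_mk _)
    (by
      rintro _ ⟨i | i, rfl⟩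
      · exact (congrArg (Polynomial.coeff · 0) (hφx i)).trans Polynomial.coeff_C_zero
      · refine Fin.cases ?_ (fun i => ?_) i
        · refine (congrArg (Polynomial.coeff · 0) hφy).trans ?_
          simp [hy, yA]
        · refine (congrArg (Polynomial.coeff · 0) (hφv i)).trans ?_
          simp [hw, hv])
    (by
      rintro _ ⟨i | i, rfl⟩
      · exact iter_of_C _ (hφx i)
      · refine Fin.cases iter_y (fun i => iter_v i) i) with hψ
  refine ⟨ψ, fun htop => ?_, hφx, fun i hi => ?_⟩
  · have h1 : v j ∈ ψ.invariants := htop ▸ Algebra.mem_top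
    have h2 := (hφv j).symm.trans h1
    rw [hw] at h2
    exact hρ0 (by simpa using congrArg (Polynomial.coeff · 1) h2)
  · exact (hφv i).trans (by simp [hw, hv, hi])

end Elementary

theorem statement11 (k : Type) [Field k] (m : ℕ) (hm : 1 < m)
    (r : Fin m → ℕ) (hr : ∀ i, 1 < r i)
    (F : MvPolynomial (Fin m ⊕ Fin 2) k) (hf : fOf k m F ≠ 0)
    [IsDomain (RingA k m r F)]
    (hlt : BA k m r F < Derksen k (RingA k m r F)) :
    ∃ l : Fin m,
      yL k m r F l ∈ Derksen (RatFunc k) (RingAL k m r F l) ∧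
      Derksen (RatFunc k) (RingAL k m r F l) = ⊤ := by
  obtain ⟨ψ, hψ, hy, hhom⟩ := exists_expMap_y_invariant hr hf hlt
  obtain ⟨l, hl⟩ := exists_x_invariant hm hr hf ψ hhom
  have key (s : VarL m l) (ψ : ExpMap k (RingA k m r (leadF F))) (hψ : ψ.invariants ≠ ⊤)
      (hx : xA k m r (leadF F) l ∈ ψ.invariants)
      (hs : Ideal.Quotient.mk _ (X (Sum.map (·.1) id s)) ∈ ψ.invariants) :
      (Ideal.Quotient.mk _ (X s) : RingAL k m r F l) ∈
        Derksen (RatFunc k) (RingAL k m r F l) := by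
    obtain ⟨Ψ, hΨ, hinv⟩ := exists_extend hr hf ψ hψ hx
    have h := ExpMap.invariants_le_derksen hΨ (hinv _ hs)
    rwa [toAL_var] at h
  have hyL : yL k m r F l ∈ Derksen (RatFunc k) (RingAL k m r F l) :=
    key (Sum.inr 0) ψ hψ hl hy
  refine ⟨l, hyL, ?_⟩
  rw [eq_top_iff, ← adjoin_range_toAL_var]
  refine Algebra.adjoin_le ?_
  rintro _ ⟨i | i, rfl⟩
  · obtain ⟨ψ', hψ', hx, -⟩ := exists_elementary (r := r) hr hf 0
    exact key (Sum.inl i) ψ' hψ' (hx l) (hx i)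
  · refine Fin.cases hyL (fun i => ?_) i
    obtain ⟨j, hj⟩ := exists_ne i
    obtain ⟨ψ', hψ', hx, hv⟩ := exists_elementary (r := r) hr hf j
    exact key (Sum.inr i.succ) ψ' hψ' (hx l) (hv i hj.symm)
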